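/- arXiv:2502.09576 — 4 statements merged into one kernel-verified Lean document; each statement's English description precedes it below -/
import Mathlib

section
/- Upper bound of Theorem 1.1: For all integers t ≥ s ≥ 3, every integer d ≥ 1 and every ε > 0, there exists a constant C = C(s,t,d,ε) such that the following holds. If G is a finite simple graph on n vertices that is K_s-free, has VC-dimension at most d, and has minimum degree δ(G) ≥ (((s−3)(t−s+2)+1)/((s−2)(t−s+2)+1) + ε)·n, then there exists a K_t-free graph H with at most C vertices and a graph homomorphism from G to H. -/
open SimpleGraph

/-- A set `S` of vertices of a graph `G` is shattered if every subset of `S` is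
a trace of a vertex neighborhood on `S`. -/
def Shattered {V : Type*} (G : SimpleGraph V) (S : Set V) : Prop :=
  ∀ S' ⊆ S, ∃ v : V, G.neighborSet v ∩ S = S'

/-- The VC-dimension of `G` is at most `d`: every shattered set has size at most `d`. -/
def VCdimLE {V : Type*} (G : SimpleGraph V) (d : ℕ) : Prop :=
  ∀ S : Set V, Shattered G S → S.ncard ≤ d

open Finset in
/-- A shattered-set bound `d` forces pairwise `η`-separated neighborhoods to be few. -/
theorem exists_card_le_of_separated (d : ℕ) (η : ℝ) (hη : 0 < η) (hη1 : η < 1) :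
    ∃ K : ℕ, ∀ (V : Type) [Fintype V] [DecidableEq V] (G : SimpleGraph V) [DecidableRel G.Adj],
      VCdimLE G d → ∀ M : Finset V,
      (∀ u ∈ M, ∀ v ∈ M, u ≠ v →
        η * Fintype.card V < #(symmDiff (G.neighborFinset u) (G.neighborFinset v))) →
      #M ≤ K := by
  obtain ⟨k, hk⟩ : ∃ k : ℕ, (((d + 1) * (k + 1) ^ d + 1 : ℕ) : ℝ) ^ 2 * (1 - η) ^ k < 1 := by
    have hq : |1 - η| < 1 := by rw [abs_lt]; constructor <;> linarith
    have h := (tendsto_pow_const_mul_const_pow_of_abs_lt_one (2 * d) hq).const_mul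
      (((d : ℝ) + 2) ^ 2 * 2 ^ (2 * d))
    rw [mul_zero] at h
    obtain ⟨k, hk, hk1⟩ :=
      ((h.eventually_lt_const one_pos).and (Filter.eventually_ge_atTop 1)).exists
    refine ⟨k, lt_of_le_of_lt ?_ hk⟩
    have hk1' : (1 : ℝ) ≤ k := by exact_mod_cast hk1
    have h0 : (0 : ℝ) ≤ (1 - η) ^ k := pow_nonneg (by linarith) _
    have h1 : (((d + 1) * (k + 1) ^ d + 1 : ℕ) : ℝ) ≤ (d + 2) * (2 * k) ^ d := by
      push_cast
      have h2 : ((k : ℝ) + 1) ^ d ≤ (2 * k) ^ d := by gcongr; linarith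
      have h3 : (1 : ℝ) ≤ (2 * k) ^ d := one_le_pow₀ (by linarith)
      nlinarith [mul_le_mul_of_nonneg_left h2 (by positivity : (0 : ℝ) ≤ d + 1)]
    calc _ ≤ ((d + 2) * (2 * (k : ℝ)) ^ d) ^ 2 * (1 - η) ^ k := by gcongr
      _ = _ := by ring
  refine ⟨(d + 1) * (k + 1) ^ d, fun V _ _ G _ hG M hM ↦ ?_⟩
  set L := (d + 1) * (k + 1) ^ d with hL
  by_contra! hlt
  obtain ⟨M', hM', hcard⟩ := exists_subset_card_eq (Nat.succ_le_of_lt hlt)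
  have hn : 0 < Fintype.card V := by
    obtain ⟨v, -⟩ := card_pos.1 (Nat.zero_lt_of_lt hlt)
    exact Fintype.card_pos_iff.2 ⟨v⟩
  let bad : V × V → Finset (Fin k → V) := fun p ↦
    Fintype.piFinset fun _ ↦ (symmDiff (G.neighborFinset p.1) (G.neighborFinset p.2))ᶜ
  have hbad : ∀ p ∈ M'.offDiag, (#(bad p) : ℝ) ≤ ((1 - η) * Fintype.card V) ^ k := by
    intro p hp
    rw [mem_offDiag] at hp
    have := hM _ (hM' hp.1) _ (hM' hp.2.1) hp.2.2
    simp only [bad, Fintype.card_piFinset, prod_const, card_univ, Fintype.card_fin, Nat.cast_pow]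
    gcongr
    rw [card_compl, Nat.cast_sub (card_le_univ _)]
    linarith
  obtain ⟨f, hf⟩ : ∃ f, f ∉ M'.offDiag.biUnion bad := by
    by_contra! h
    have h1 : Fintype.card V ^ k ≤ ∑ p ∈ M'.offDiag, #(bad p) := by
      calc Fintype.card V ^ k = #(univ : Finset (Fin k → V)) := by simp
        _ ≤ #(M'.offDiag.biUnion bad) := card_le_card fun f _ ↦ h f
        _ ≤ _ := card_biUnion_le
    have h2 : (Fintype.card V : ℝ) ^ k
        ≤ ((L + 1 : ℕ) : ℝ) ^ 2 * (1 - η) ^ k * (Fintype.card V : ℝ) ^ k := by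
      calc (Fintype.card V : ℝ) ^ k ≤ ∑ p ∈ M'.offDiag, (#(bad p) : ℝ) := by exact_mod_cast h1
        _ ≤ ∑ p ∈ M'.offDiag, ((1 - η) * Fintype.card V) ^ k := sum_le_sum hbad
        _ = (#M'.offDiag : ℝ) * ((1 - η) * Fintype.card V) ^ k := by simp
        _ ≤ ((L + 1 : ℕ) : ℝ) ^ 2 * ((1 - η) * Fintype.card V) ^ k := by
          have h3 : (#M'.offDiag : ℝ) ≤ ((L + 1 : ℕ) : ℝ) ^ 2 := by
            rw [offDiag_card, hcard]
            exact_mod_cast (Nat.sub_le _ _).trans (by rw [sq])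
          have : 0 ≤ 1 - η := by linarith
          gcongr
        _ = _ := by rw [mul_pow, mul_assoc]
    have h4 : (0 : ℝ) < (Fintype.card V : ℝ) ^ k := by positivity
    nlinarith
  let Y : Finset V := univ.image f
  have hYk : #Y ≤ k := card_image_le.trans (by simp)
  have hinj : Set.InjOn (fun u ↦ G.neighborFinset u ∩ Y) M' := by
    intro u hu v hv huv
    by_contra hne
    refine hf (mem_biUnion.2 ⟨(u, v), mem_offDiag.2 ⟨hu, hv, hne⟩, ?_⟩)
    simp only [bad, Fintype.mem_piFinset, mem_compl]
    intro i hi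
    have := Finset.ext_iff.1 huv (f i)
    have hfi : f i ∈ Y := mem_image_of_mem _ (mem_univ _)
    simp only [mem_inter, hfi, and_true] at this
    rw [mem_symmDiff] at hi
    tauto
  let 𝒜 := M'.image fun u ↦ G.neighborFinset u ∩ Y
  have h𝒜 : #𝒜 = L + 1 := by rw [card_image_of_injOn hinj, hcard]
  have hsub : 𝒜.shatterer ⊆ (range (d + 1)).biUnion fun i ↦ Y.powersetCard i := by
    intro S hS
    rw [mem_shatterer] at hS
    have hSY : S ⊆ Y := by
      obtain ⟨u, hu, hSu⟩ := hS.exists_superset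
      obtain ⟨v, -, rfl⟩ := mem_image.1 hu
      exact hSu.trans inter_subset_right
    have hSd : #S ≤ d := by
      rw [← Set.ncard_coe_finset]
      refine hG _ fun S' hS' ↦ ?_
      classical
      obtain ⟨u, hu, hSu⟩ := hS (filter_subset (· ∈ S') S)
      obtain ⟨v, -, rfl⟩ := mem_image.1 hu
      refine ⟨v, Set.ext fun y ↦ ?_⟩
      have := Finset.ext_iff.1 hSu y
      simp only [mem_inter, mem_neighborFinset, mem_filter] at this
      simp only [Set.mem_inter_iff, mem_neighborSet, mem_coe]
      constructor
      · rintro ⟨h1, h2⟩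
        exact (this.1 ⟨h2, h1, hSY h2⟩).2
      · intro h
        have h2 : y ∈ S := hS' h
        exact ⟨(this.2 ⟨h2, h⟩).2.1, h2⟩
    exact mem_biUnion.2 ⟨#S, mem_range.2 (by omega), mem_powersetCard.2 ⟨hSY, rfl⟩⟩
  have : #𝒜 ≤ L :=
    calc #𝒜 ≤ #𝒜.shatterer := card_le_card_shatterer _
      _ ≤ _ := card_le_card hsub
      _ ≤ ∑ i ∈ range (d + 1), #(Y.powersetCard i) := card_biUnion_le
      _ ≤ ∑ i ∈ range (d + 1), (k + 1) ^ d := by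
        refine sum_le_sum fun i hi ↦ ?_
        rw [card_powersetCard]
        calc (#Y).choose i ≤ (#Y) ^ i := Nat.choose_le_pow _ _
          _ ≤ (k + 1) ^ i := Nat.pow_le_pow_left (by omega) _
          _ ≤ (k + 1) ^ d := Nat.pow_le_pow_right (by omega) (by simpa [Nat.lt_succ_iff] using hi)
      _ = L := by simp [hL]
  omega

open Finset in
/-- In bounded VC-dimension, the vertices fall into boundedly many classes of near-twins. -/
theorem exists_near_twin_classes (d : ℕ) (η : ℝ) (hη : 0 < η) (hη1 : η < 1) :
    ∃ K : ℕ, ∀ (V : Type) [Fintype V] [DecidableEq V] (G : SimpleGraph V) [DecidableRel G.Adj],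
      VCdimLE G d → ∃ c : V → V, (Set.range c).ncard ≤ K ∧ ∀ u v, c u = c v →
        (#(G.neighborFinset u \ G.neighborFinset v) : ℝ) ≤ 2 * η * Fintype.card V := by
  obtain ⟨K, hK⟩ := exists_card_le_of_separated d η hη hη1
  refine ⟨K, fun V _ _ G _ hG ↦ ?_⟩
  classical
  let sep : Finset V → Prop := fun M ↦ ∀ u ∈ M, ∀ v ∈ M, u ≠ v →
    η * Fintype.card V < #(symmDiff (G.neighborFinset u) (G.neighborFinset v))
  obtain ⟨M, hM, hmax⟩ := exists_max_image (univ.filter sep) card ⟨∅, by simp [sep]⟩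
  rw [mem_filter] at hM
  have hc : ∀ u, ∃ w ∈ M,
      (#(symmDiff (G.neighborFinset u) (G.neighborFinset w)) : ℝ) ≤ η * Fintype.card V := by
    intro u
    by_contra! h
    have huM : u ∉ M := fun hu ↦ by
      have := h u hu
      simp only [symmDiff_self, bot_eq_empty, card_empty, Nat.cast_zero] at this
      exact absurd this (not_lt.2 (by positivity))
    have hs : sep (insert u M) := by
      intro a ha b hb hab
      rcases mem_insert.1 ha with rfl | ha' <;> rcases mem_insert.1 hb with rfl | hb'
      · exact absurd rfl hab
      · exact h b hb'
      · rw [symmDiff_comm]; exact h a ha'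
      · exact hM.2 a ha' b hb' hab
    have := hmax _ (mem_filter.2 ⟨mem_univ _, hs⟩)
    rw [card_insert_of_notMem huM] at this
    omega
  choose c hcM hcd using hc
  refine ⟨c, ?_, fun u v huv ↦ ?_⟩
  · calc (Set.range c).ncard ≤ (M : Set V).ncard :=
          Set.ncard_le_ncard (by rintro _ ⟨u, rfl⟩; exact hcM u) M.finite_toSet
      _ = #M := Set.ncard_coe_finset _
      _ ≤ K := hK V G hG M hM.2
  · have hsub : G.neighborFinset u \ G.neighborFinset v ⊆
        symmDiff (G.neighborFinset u) (G.neighborFinset (c u)) ∪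
          symmDiff (G.neighborFinset v) (G.neighborFinset (c u)) := by
      intro y
      simp only [mem_sdiff, mem_union, mem_symmDiff]
      tauto
    have h1 : (#(G.neighborFinset u \ G.neighborFinset v) : ℝ) ≤
        #(symmDiff (G.neighborFinset u) (G.neighborFinset (c u))) +
          #(symmDiff (G.neighborFinset v) (G.neighborFinset (c u))) := by
      exact_mod_cast (card_le_card hsub).trans (card_union_le _ _)
    have h2 := hcd u
    have h3 := hcd v
    rw [← huv] at h3
    linarith

open Finset in
/-- If every vertex has few non-neighbors, there is a sequence of `k + 1` pairwise adjacent
vertices chosen greedily to minimize `p`. -/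
theorem exists_greedy_clique {V : Type*} [Fintype V] [DecidableEq V] [Nonempty V]
    (G : SimpleGraph V) [DecidableRel G.Adj] (p : V → ℕ) (k r : ℕ)
    (hdeg : ∀ v, (k * r + 1) * #(G.neighborFinset v)ᶜ < r * Fintype.card V) (m : ℕ)
    (hm : m ≤ k + 1) :
    ∃ x : ℕ → V, ∀ j < m, (∀ i < j, G.Adj (x i) (x j)) ∧
      ∀ y, (∀ i < j, G.Adj (x i) y) → p (x j) ≤ p y := by
  induction m with
  | zero => exact ⟨fun _ ↦ Classical.arbitrary V, by simp⟩
  | succ m ih =>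
    obtain ⟨x, hx⟩ := ih (by omega)
    let S : Finset V := univ.filter fun y ↦ ∀ i < m, G.Adj (x i) y
    have hS : S.Nonempty := by
      by_contra hS
      rw [not_nonempty_iff_eq_empty] at hS
      have hcov : (univ : Finset V) ⊆ (range m).biUnion fun i ↦ (G.neighborFinset (x i))ᶜ := by
        intro y _
        by_contra hy
        have : y ∈ S := by
          simp only [S, mem_filter, mem_univ, true_and]
          intro i hi
          by_contra h
          exact hy (mem_biUnion.2 ⟨i, mem_range.2 hi, by simpa using h⟩)
        simp [hS] at this
      have h1 : Fintype.card V ≤ ∑ i ∈ range m, #(G.neighborFinset (x i))ᶜ :=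
        (card_le_card hcov).trans card_biUnion_le
      have h2 : (k * r + 1) * Fintype.card V ≤ m * (r * Fintype.card V) := by
        calc _ ≤ (k * r + 1) * ∑ i ∈ range m, #(G.neighborFinset (x i))ᶜ := by gcongr
          _ = ∑ i ∈ range m, (k * r + 1) * #(G.neighborFinset (x i))ᶜ := mul_sum _ _ _
          _ ≤ ∑ i ∈ range m, r * Fintype.card V := sum_le_sum fun i _ ↦ (hdeg _).le
          _ = _ := by simp
      have h3 : m * (r * Fintype.card V) ≤ k * (r * Fintype.card V) := by gcongr; omega
      have h4 : 0 < Fintype.card V := Fintype.card_pos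
      nlinarith
    obtain ⟨z, hz, hzmin⟩ := exists_min_image S p hS
    simp only [S, mem_filter, mem_univ, true_and] at hz hzmin
    refine ⟨fun i ↦ if i = m then z else x i, fun j hj ↦ ?_⟩
    have hlt : ∀ i < j, (if i = m then z else x i) = x i := fun i hi ↦ if_neg (by omega)
    rcases Nat.lt_succ_iff_lt_or_eq.1 hj with hj' | rfl
    · refine ⟨fun i hi ↦ ?_, fun y hy ↦ ?_⟩
      · simp only [hlt i hi, if_neg hj'.ne]
        exact (hx j hj').1 i hi
      · simp only [if_neg hj'.ne]
        exact (hx j hj').2 y fun i hi ↦ by simpa only [hlt i hi] using hy i hi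
    · refine ⟨fun i hi ↦ ?_, fun y hy ↦ ?_⟩
      · simp only [hlt i hi, if_true]
        exact hz i hi
      · simp only [if_true]
        exact hzmin y fun i hi ↦ by simpa only [hlt i hi] using hy i hi

open Finset in
/-- The sets `J j` record which members of a family of sets miss the `j`-th vertex of a clique;
the hypothesis says that two members of the family share no `k` vertices of it. -/
theorem card_le_sum_or_of_clique {ι : Type*} [Fintype ι] [DecidableEq ι] (k : ℕ) (hk : 1 ≤ k)
    (J : ℕ → Finset ι)
    (hJ : ∀ j ≤ k, ∀ a b, (∀ l ≤ k, l ≠ j → a ∉ J l ∧ b ∉ J l) → a = b) :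
    Fintype.card ι ≤ ∑ j ∈ range k, #(J j) ∨
      Fintype.card ι ≤ ∑ j ∈ range k, #(J j) + 1 ∧ Fintype.card ι ≤ #(J k) + k := by
  let c : ι → ℕ := fun i ↦ #{j ∈ range k | i ∈ J j}
  have hP : ∑ j ∈ range k, #(J j) = ∑ i, c i := by
    have := sum_card_bipartiteAbove_eq_sum_card_bipartiteBelow (s := range k)
      (t := (univ : Finset ι)) (fun j i ↦ i ∈ J j)
    simpa [bipartiteAbove, bipartiteBelow, c] using this
  have hzero : #{i | c i = 0} ≤ 1 := by
    refine card_le_one.2 fun a ha b hb ↦ hJ k le_rfl a b fun l hl hlk ↦ ?_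
    simp only [mem_filter, mem_univ, true_and, c, card_eq_zero, filter_eq_empty_iff,
      mem_range] at ha hb
    exact ⟨ha (by omega), hb (by omega)⟩
  rw [card_filter] at hzero
  have hone : Fintype.card ι ≤ ∑ i, c i + 1 := by
    calc Fintype.card ι = ∑ i : ι, 1 := by simp
      _ ≤ ∑ i, (c i + if c i = 0 then 1 else 0) := sum_le_sum fun i _ ↦ by split_ifs <;> omega
      _ ≤ _ := by rw [sum_add_distrib]; omega
  rw [hP]
  by_cases h2 : ∃ i₀, 2 ≤ c i₀
  · obtain ⟨i₀, hi₀⟩ := h2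
    left
    have : Fintype.card ι + 1 ≤ ∑ i, c i + 1 := by
      calc Fintype.card ι + 1 = ∑ i : ι, (1 + if i = i₀ then 1 else 0) := by
            simp [sum_add_distrib]
        _ ≤ ∑ i, (c i + if c i = 0 then 1 else 0) := sum_le_sum fun i _ ↦ by
            by_cases h : i = i₀
            · subst h; simp; omega
            · simp only [if_neg h]; split_ifs <;> omega
        _ ≤ _ := by rw [sum_add_distrib]; omega
    omega
  · push Not at h2
    refine Or.inr ⟨hone, ?_⟩
    have hφ : ∀ i, ∃ j < k, ∀ l < k, l ≠ j → i ∉ J l := by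
      intro i
      by_cases h : ∃ j < k, i ∈ J j
      · obtain ⟨j, hj, hij⟩ := h
        refine ⟨j, hj, fun l hl hlj hil ↦ hlj ?_⟩
        exact card_le_one.1 (Nat.lt_succ_iff.1 (h2 i)) l (by simp [hl, hil]) j (by simp [hj, hij])
      · push Not at h
        exact ⟨0, by omega, fun l hl _ ↦ h l hl⟩
    choose φ hφk hφ using hφ
    have hI : #(J k)ᶜ ≤ k := by
      by_contra! hlt
      obtain ⟨a, ha, b, hb, hab, heq⟩ := exists_ne_map_eq_of_card_lt_of_maps_to
        (t := range k) (by simpa using hlt) (f := φ) (fun i _ ↦ by simpa using hφk i)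
      rw [mem_compl] at ha hb
      refine hab (hJ (φ a) (hφk a).le a b fun l hl hne ↦ ?_)
      rcases hl.lt_or_eq with hl | rfl
      · exact ⟨hφ a l hl hne, hφ b l hl (heq ▸ hne)⟩
      · exact ⟨ha, hb⟩
    have := card_add_card_compl (J k)
    omega

open Finset in
/-- Under the minimum degree condition, among `r + k` large vertex sets two distinct ones
have a `k`-clique in their intersection. -/
theorem false_of_large_sets {V ι : Type*} [Fintype V] [DecidableEq V] [Fintype ι] [DecidableEq ι]
    (G : SimpleGraph V) [DecidableRel G.Adj] (k r : ℕ) (hk : 1 ≤ k)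
    (hι : Fintype.card ι = r + k) (A : ι → Finset V)
    (hA : ∀ i, (k * r + 1) * #(A i)ᶜ < r * Fintype.card V)
    (hdeg : ∀ v, (k * r + 1) * #(G.neighborFinset v)ᶜ < r * Fintype.card V)
    (hQ : ∀ Q : Finset V, G.IsNClique k Q → ∀ a b, Q ⊆ A a → Q ⊆ A b → a = b) : False := by
  have hne : Nonempty ι := Fintype.card_pos_iff.1 (by omega)
  have hn : 0 < Fintype.card V := by
    by_contra! h
    have := hA hne.some
    rw [Nat.le_zero.1 h] at this
    omega
  have : Nonempty V := Fintype.card_pos_iff.1 hn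
  let J : V → Finset ι := fun y ↦ {i | y ∉ A i}
  obtain ⟨x, hx⟩ := exists_greedy_clique G (fun y ↦ #(J y)) k r hdeg (k + 1) le_rfl
  have hadj : ∀ i ≤ k, ∀ j ≤ k, i ≠ j → G.Adj (x i) (x j) := by
    intro i hi j hj hij
    rcases lt_or_gt_of_ne hij with h | h
    · exact (hx j (by omega)).1 i h
    · exact ((hx i (by omega)).1 j h).symm
  have hcomb := card_le_sum_or_of_clique k hk (fun j ↦ J (x j)) (by
    intro j hj a b hab
    refine hQ (((range (k + 1)).erase j).image x) ?_ a b ?_ ?_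
    · rw [isNClique_iff]
      constructor
      · intro u hu v hv huv
        simp only [coe_image, Set.mem_image, mem_coe, mem_erase, mem_range] at hu hv
        obtain ⟨i, hi, rfl⟩ := hu
        obtain ⟨l, hl, rfl⟩ := hv
        exact hadj i (by omega) l (by omega) fun h ↦ huv (h ▸ rfl)
      · rw [card_image_of_injOn, card_erase_of_mem (by simp; omega), card_range,
          Nat.add_sub_cancel]
        intro i hi l hl hil
        simp only [coe_erase, coe_range, Set.mem_sdiff, Set.mem_Iio] at hi hl
        by_contra hne
        exact (hadj i (by omega) l (by omega) hne).ne hil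
    all_goals
      intro u hu
      simp only [mem_image, mem_erase, mem_range] at hu
      obtain ⟨i, hi, rfl⟩ := hu
      have := hab i (by omega) hi.1
      simp only [J, mem_filter, mem_univ, true_and, not_not] at this
      tauto)
  have hmono : ∀ j < k, #(J (x j)) ≤ #(J (x k)) := fun j hj ↦
    (hx j (by omega)).2 (x k) fun i hi ↦ hadj i (by omega) k le_rfl (by omega)
  let b : ℕ → ℕ := fun j ↦ #(J (x k)) - #(J (x j))
  have hpt : ∀ y, #(J (x k)) ≤
      #(J y) + ∑ j ∈ range k, if y ∈ (G.neighborFinset (x j))ᶜ then b j else 0 := by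
    intro y
    by_cases hy : ∀ j < k, G.Adj (x j) y
    · exact ((hx k (by omega)).2 y hy).trans (Nat.le_add_right _ _)
    · push Not at hy
      have hspec := Nat.find_spec hy
      set j := Nat.find hy
      have h1 : #(J (x j)) ≤ #(J y) := (hx j (by omega)).2 y fun i hi ↦ by
        have := Nat.find_min hy hi
        push Not at this
        exact this (by omega)
      have h2 := single_le_sum (f := fun j ↦ if y ∈ (G.neighborFinset (x j))ᶜ then b j else 0)
        (fun _ _ ↦ Nat.zero_le _) (mem_range.2 hspec.1)
      have h3 : y ∈ (G.neighborFinset (x j))ᶜ := by simpa using hspec.2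
      rw [if_pos h3] at h2
      simp only [b] at h2 ⊢
      omega
  have hJsum : ∑ y, #(J y) = ∑ i, #(A i)ᶜ := by
    have := sum_card_bipartiteAbove_eq_sum_card_bipartiteBelow (s := (univ : Finset V))
      (t := (univ : Finset ι)) (fun y i ↦ y ∉ A i)
    simp only [bipartiteAbove, bipartiteBelow] at this
    rw [this]
    exact sum_congr rfl fun i _ ↦ congrArg card (by ext; simp)
  have hcount : Fintype.card V * #(J (x k)) ≤
      ∑ i, #(A i)ᶜ + ∑ j ∈ range k, b j * #(G.neighborFinset (x j))ᶜ := by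
    calc Fintype.card V * #(J (x k)) = ∑ _y : V, #(J (x k)) := by simp
      _ ≤ _ := sum_le_sum fun y _ ↦ hpt y
      _ = _ := by
        rw [sum_add_distrib, hJsum, sum_comm]
        congr 1
        refine sum_congr rfl fun j _ ↦ ?_
        rw [← sum_filter, sum_const, smul_eq_mul, mul_comm]
        congr 2
        ext; simp
  have hstrict : (k * r + 1) * (Fintype.card V * #(J (x k))) <
      (r * Fintype.card V) * (r + k + ∑ j ∈ range k, b j) := by
    calc _ ≤ (k * r + 1) * (∑ i, #(A i)ᶜ + ∑ j ∈ range k, b j * #(G.neighborFinset (x j))ᶜ) :=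
          Nat.mul_le_mul_left _ hcount
      _ = ∑ i, (k * r + 1) * #(A i)ᶜ +
          ∑ j ∈ range k, b j * ((k * r + 1) * #(G.neighborFinset (x j))ᶜ) := by
        rw [mul_add, mul_sum, mul_sum]
        congr 1
        exact sum_congr rfl fun j _ ↦ by ring
      _ < ∑ _i : ι, r * Fintype.card V + ∑ j ∈ range k, b j * (r * Fintype.card V) :=
        add_lt_add_of_lt_of_le (sum_lt_sum_of_nonempty univ_nonempty fun i _ ↦ hA i)
          (sum_le_sum fun j _ ↦ Nat.mul_le_mul_left _ (hdeg _).le)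
      _ = _ := by
        rw [sum_const, card_univ, hι, ← sum_mul, smul_eq_mul]
        ring
  have hb : ∑ j ∈ range k, b j + ∑ j ∈ range k, #(J (x j)) = k * #(J (x k)) := by
    rw [← sum_add_distrib]
    calc _ = ∑ _j ∈ range k, #(J (x k)) := sum_congr rfl fun j hj ↦
          Nat.sub_add_cancel (hmono j (mem_range.1 hj))
      _ = _ := by simp
  have hfin : (k * r + 1) * #(J (x k)) < r * (r + k + ∑ j ∈ range k, b j) := by
    refine Nat.lt_of_mul_lt_mul_left (a := Fintype.card V) ?_
    linarith
  rw [hι] at hcomb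
  generalize ∑ j ∈ range k, b j = B at *
  generalize ∑ j ∈ range k, #(J (x j)) = P at *
  generalize #(J (x k)) = p at *
  have key : p + r * P < r * (r + k) := by nlinarith
  rcases hcomb with h | ⟨h, h'⟩
  · nlinarith
  · nlinarith

open Finset in
/-- If every class of near-twins is a vertex of a quotient, `r + k` pairwise adjacent (possibly
repeated) classes cannot occur. -/
theorem false_of_adjacent_classes {V ι : Type*} [Fintype V] [DecidableEq V] [Fintype ι]
    [DecidableEq ι] (G : SimpleGraph V) [DecidableRel G.Adj] (k r : ℕ) (hk : 1 ≤ k)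
    (hι : Fintype.card ι = r + k) (hG : G.CliqueFree (k + 2)) (ε η : ℝ) (hε : 0 < ε)
    (hηε : (r + k) * η < ε)
    (hdeg : ∀ v, (((k - 1) * r + 1) / (k * r + 1) + ε) * Fintype.card V ≤
      (#(G.neighborFinset v) : ℝ))
    (u : ι → ι → V)
    (htwin : ∀ i j l, (#(G.neighborFinset (u i j) \ G.neighborFinset (u i l)) : ℝ) ≤
      η * Fintype.card V)
    (hu : ∀ i j, i ≠ j → G.Adj (u i j) (u j i)) : False := by
  have hpos : (0 : ℝ) < k * r + 1 := by positivity
  have hn : (0 : ℝ) < Fintype.card V := by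
    have hne : Nonempty ι := Fintype.card_pos_iff.1 (by omega)
    exact_mod_cast Fintype.card_pos_iff.2 ⟨u hne.some hne.some⟩
  have hcompl : ∀ v, (#(G.neighborFinset v)ᶜ : ℝ) ≤
      (r / (k * r + 1) - ε) * Fintype.card V := by
    intro v
    rw [card_compl, Nat.cast_sub (card_le_univ _)]
    have h1 : (((k : ℝ) - 1) * r + 1) / (k * r + 1) = 1 - r / (k * r + 1) := by
      field_simp; ring
    have := hdeg v
    rw [h1] at this
    linarith
  have hlt : ∀ m : ℕ, (m : ℝ) < r / (k * r + 1) * Fintype.card V →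
      (k * r + 1) * m < r * Fintype.card V := by
    intro m hm
    have h1 : ((k : ℝ) * r + 1) * m < r * Fintype.card V := by
      calc ((k : ℝ) * r + 1) * m < (k * r + 1) * (r / (k * r + 1) * Fintype.card V) := by gcongr
        _ = r * Fintype.card V := by field_simp
    exact_mod_cast h1
  let A : ι → Finset V := fun i ↦ {y | ∀ j, G.Adj (u i j) y}
  refine false_of_large_sets G k r hk hι A (fun i ↦ hlt _ ?_) (fun v ↦ hlt _ ?_) ?_
  · have hsub : (A i)ᶜ ⊆ (G.neighborFinset (u i i))ᶜ ∪
        univ.biUnion fun j ↦ G.neighborFinset (u i i) \ G.neighborFinset (u i j) := by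
      intro y hy
      simp only [A, mem_compl, mem_filter, mem_univ, true_and, not_forall] at hy
      obtain ⟨j, hj⟩ := hy
      simp only [mem_union, mem_compl, mem_biUnion, mem_univ, true_and, mem_sdiff,
        mem_neighborFinset]
      by_cases h : G.Adj (u i i) y
      · exact Or.inr ⟨j, h, hj⟩
      · exact Or.inl h
    have h1 : #(A i)ᶜ ≤ #(G.neighborFinset (u i i))ᶜ +
        ∑ j, #(G.neighborFinset (u i i) \ G.neighborFinset (u i j)) :=
      (card_le_card hsub).trans ((card_union_le _ _).trans (by gcongr; exact card_biUnion_le))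
    have h2 : ∑ j, (#(G.neighborFinset (u i i) \ G.neighborFinset (u i j)) : ℝ) ≤
        (r + k) * (η * Fintype.card V) := by
      calc _ ≤ ∑ _j : ι, η * (Fintype.card V : ℝ) := sum_le_sum fun j _ ↦ htwin i i j
        _ = _ := by simp [hι]
    have h3 : (#(A i)ᶜ : ℝ) ≤ #(G.neighborFinset (u i i))ᶜ +
        ∑ j, (#(G.neighborFinset (u i i) \ G.neighborFinset (u i j)) : ℝ) := by
      exact_mod_cast h1
    have h4 := hcompl (u i i)
    nlinarith
  · have := hcompl v
    nlinarith
  · intro Q hQ a b ha hb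
    by_contra hab
    have h1 : ∀ y ∈ Q, G.Adj (u b a) y := fun y hy ↦ (mem_filter.1 (hb hy)).2 a
    have h2 : ∀ y ∈ insert (u b a) Q, G.Adj (u a b) y := by
      intro y hy
      rcases mem_insert.1 hy with rfl | hy
      · exact hu a b hab
      · exact (mem_filter.1 (ha hy)).2 b
    exact hG _ ((hQ.insert h1).insert h2)

/-- Upper bound of Theorem 1.1: for `t ≥ s ≥ 3`, `d ≥ 1` and `ε > 0` there is a
constant `C` such that every `Kₛ`-free graph `G` with VC-dimension at most `d`
and minimum degree at least `((s−3)(t−s+2)+1)/((s−2)(t−s+2)+1) + ε` times the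
number of vertices admits a homomorphism to a `K_t`-free graph on at most `C`
vertices. -/
theorem upper_bound_KsKt (s t d : ℕ) (hs : 3 ≤ s) (hst : s ≤ t) (hd : 1 ≤ d)
    (ε : ℝ) (hε : 0 < ε) :
    ∃ C : ℕ, ∀ (V : Type) [Fintype V] (G : SimpleGraph V),
      G.CliqueFree s → VCdimLE G d →
      (∀ v : V,
        ((((s : ℝ) - 3) * ((t : ℝ) - (s : ℝ) + 2) + 1) /
            (((s : ℝ) - 2) * ((t : ℝ) - (s : ℝ) + 2) + 1) + ε) * (Nat.card V) ≤
          (G.neighborSet v).ncard) →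
      ∃ (W : Type) (_ : Finite W) (H : SimpleGraph W),
        Nat.card W ≤ C ∧ H.CliqueFree t ∧ Nonempty (G →g H) := by
  classical
  obtain ⟨k, rfl⟩ : ∃ k, s = k + 2 := ⟨s - 2, by omega⟩
  obtain ⟨r, rfl⟩ : ∃ r, t = r + k := ⟨t - k, by omega⟩
  have hk : 1 ≤ k := by omega
  have hrk : (0 : ℝ) < r + k := by positivity
  let η : ℝ := min (1 / 2) (ε / (4 * (r + k)))
  have hη : 0 < η := lt_min (by norm_num) (by positivity)
  have hη1 : η < 1 := (min_le_left _ _).trans_lt (by norm_num)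
  have hηε : (r + k) * (2 * η) < ε := by
    have h1 : η ≤ ε / (4 * (r + k)) := min_le_right _ _
    calc (r + k) * (2 * η) ≤ (r + k) * (2 * (ε / (4 * (r + k)))) := by gcongr
      _ = ε / 2 := by field_simp; norm_num
      _ < ε := by linarith
  obtain ⟨K, hK⟩ := exists_near_twin_classes d η hη hη1
  refine ⟨K, fun V _ G hG hVC hdeg ↦ ?_⟩
  obtain ⟨c, hcK, hc⟩ := hK V G hVC
  have hdeg' : ∀ v, ((((k : ℝ) - 1) * r + 1) / (k * r + 1) + ε) * Fintype.card V ≤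
      ((G.neighborFinset v).card : ℝ) := by
    intro v
    have h := hdeg v
    rw [Nat.card_eq_fintype_card, ← coe_neighborFinset, Set.ncard_coe_finset] at h
    convert h using 4 <;> push_cast <;> ring
  have main (u : Fin (r + k) → Fin (r + k) → V) (hcu : ∀ i j l, c (u i j) = c (u i l))
      (hu : ∀ i j, i ≠ j → G.Adj (u i j) (u j i)) : False :=
    false_of_adjacent_classes G k r hk (by simp) hG ε (2 * η) hε hηε hdeg' u
      (fun i j l ↦ hc _ _ (hcu i j l)) hu
  have hproper : ∀ a b, G.Adj a b → c a ≠ c b := by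
    intro a b hab heq
    refine main (fun i j ↦ if i < j then a else b) ?_ ?_
    · intro i j l
      split_ifs <;> simp [heq]
    · intro i j hij
      rcases lt_or_gt_of_ne hij with h | h
      · simpa [h, h.not_gt] using hab
      · simpa [h, h.not_gt] using hab.symm
  let H : SimpleGraph (Set.range c) :=
    SimpleGraph.mk (fun x y ↦ ∃ a b, c a = x ∧ c b = y ∧ G.Adj a b)
      (symm := ⟨fun x y ⟨a, b, ha, hb, hab⟩ ↦ ⟨b, a, hb, ha, hab.symm⟩⟩)
      (loopless := ⟨fun x ⟨a, b, ha, hb, hab⟩ ↦ hproper a b hab (ha.trans hb.symm)⟩)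
  refine ⟨Set.range c, inferInstance, H, hcK, ?_, ⟨fun v ↦ ⟨c v, v, rfl⟩, ?_⟩⟩
  · by_contra hfree
    obtain ⟨f⟩ := not_cliqueFree_iff_top_isContained (r + k) |>.1 hfree
    have hf : ∀ i j, i ≠ j → H.Adj (f i) (f j) := fun i j hij ↦ f.toHom.map_adj hij
    have hq : ∀ i j, ∃ q : V × V, i < j → c q.1 = f i ∧ c q.2 = f j ∧ G.Adj q.1 q.2 := by
      intro i j
      by_cases hij : i < j
      · obtain ⟨a, b, h⟩ := hf i j hij.ne
        exact ⟨(a, b), fun _ ↦ h⟩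
      · exact ⟨(f i, f j), fun h ↦ absurd h hij⟩
    choose q hq using hq
    choose g hg using fun i ↦ (f i).2
    let u : Fin (r + k) → Fin (r + k) → V := fun i j ↦
      if i < j then (q i j).1 else if j < i then (q j i).2 else g i
    have hcu : ∀ i j, c (u i j) = f i := by
      intro i j
      simp only [u]
      split_ifs with h1 h2
      · exact (hq i j h1).1
      · exact (hq j i h2).2.1
      · exact hg i
    refine main u (fun i j l ↦ by rw [hcu, hcu]) fun i j hij ↦ ?_
    rcases lt_or_gt_of_ne hij with h | h
    · simpa [u, h, h.not_gt] using (hq i j h).2.2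
    · simpa [u, h, h.not_gt] using (hq j i h).2.2.symm
  · exact fun {a b} hab ↦ ⟨a, b, rfl, rfl, hab⟩
end

section
/- Lower bound of Theorem 1.1: For all integers t ≥ s ≥ 3 and every ε > 0, there exists an integer d = d(s,t,ε) such that for every integer f ≥ 1 there exist an integer n and an n-vertex K_s-free graph G with VC-dimension at most d and minimum degree δ(G) ≥ (((s−3)(t−s+2)+1)/((s−2)(t−s+2)+1) − ε)·n, such that every graph H with at most f vertices admitting a graph homomorphism from G to H contains a clique on t vertices. -/
open SimpleGraph

/-! ### Bounding the VC-dimension -/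

theorem Shattered.mono {V : Type*} {G : SimpleGraph V} {S T : Set V} (hS : Shattered G S)
    (hT : T ⊆ S) : Shattered G T := by
  intro T' hT'
  obtain ⟨v, hv⟩ := hS T' (hT'.trans hT)
  refine ⟨v, ?_⟩
  ext x
  have := Set.ext_iff.1 hv x
  simp only [Set.mem_inter_iff] at this ⊢
  exact ⟨fun h => this.1 ⟨h.1, hT h.2⟩, fun h => ⟨(this.2 h).1, hT' h⟩⟩

/-- If the vertices are split into classes in which no three distinct vertices are shattered,
then the VC-dimension is at most twice the number of classes. -/
theorem VCdimLE.of_classes {V C : Type*} [Finite V] [Fintype C] (G : SimpleGraph V) (p : V → C)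
    (h : ∀ S, Shattered G S → ∀ a ∈ S, ∀ b ∈ S, ∀ c ∈ S, a ≠ b → a ≠ c → b ≠ c →
      p a = p b → p b = p c → False) :
    VCdimLE G (2 * Fintype.card C) := by
  classical
  have := Fintype.ofFinite V
  intro S hS
  rw [Set.ncard_eq_toFinset_card']
  refine Finset.card_le_mul_card_image_of_maps_to (f := p) (t := Finset.univ)
    (fun _ _ => Finset.mem_univ _) 2 fun c _ => ?_
  by_contra! hc
  obtain ⟨x, y, z, hx, hy, hz, hxy, hxz, hyz⟩ := Finset.two_lt_card_iff.1 hc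
  simp only [Finset.mem_filter, Set.mem_toFinset] at hx hy hz
  exact h S hS x hx.1 y hy.1 z hz.1 hxy hxz hyz (hx.2.trans hy.2.symm) (hy.2.trans hz.2.symm)

theorem Shattered.not_between {V : Type*} {G : SimpleGraph V} {S : Set V} (hS : Shattered G S)
    {a b c : V} (ha : a ∈ S) (hb : b ∈ S) (hc : c ∈ S) (hab : a ≠ b) (hcb : c ≠ b)
    (h : ∀ v, G.Adj v a → G.Adj v c → G.Adj v b) : False := by
  obtain ⟨v, hv⟩ := hS {a, c} (by rintro x (rfl | rfl) <;> assumption)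
  have h1 : a ∈ G.neighborSet v ∩ S := by simp [hv]
  have h2 : c ∈ G.neighborSet v ∩ S := by simp [hv]
  have h3 : b ∈ G.neighborSet v ∩ S := ⟨h v h1.1 h2.1, hb⟩
  rw [hv] at h3
  rcases h3 with h3 | h3
  · exact hab h3.symm
  · exact hcb h3.symm

/-! ### The lexicographic layer graph -/

/-- `x` and `y` agree before the coordinate `l`, where `x` is smaller than `y`. -/
def LexLTAt {m N : ℕ} (l : Fin m) (x y : Fin m → Fin N) : Prop :=
  (∀ l' < l, x l' = y l') ∧ x l < y l

theorem le_apply_of_toLex_lt {m N : ℕ} {l : Fin m} {x y : Fin m → Fin N}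
    (hxy : toLex x < toLex y) (h : ∀ l' < l, x l' = y l') : x l ≤ y l := by
  obtain ⟨i, hi, hlt⟩ := hxy
  rcases lt_trichotomy i l with h1 | rfl | h1
  · exact absurd (h i h1) hlt.ne
  · exact hlt.le
  · exact (hi l h1).le

theorem eq_of_toLex_between {m N : ℕ} {l : Fin m} {x y z : Fin m → Fin N}
    (hxy : toLex x < toLex y) (hyz : toLex y < toLex z) (h : ∀ l' < l, x l' = z l') :
    ∀ l' < l, x l' = y l' := by
  intro l'
  induction l' using WellFoundedLT.induction with
  | ind l' ih =>
    intro hl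
    have h1 : x l' ≤ y l' := le_apply_of_toLex_lt hxy fun j hj => ih j hj (hj.trans hl)
    have h2 : y l' ≤ z l' := le_apply_of_toLex_lt hyz fun j hj =>
      (ih j hj (hj.trans hl)).symm.trans (h j (hj.trans hl))
    exact le_antisymm h1 (h2.trans (h l' hl).ge)

theorem LexLTAt.right_between {m N : ℕ} {l : Fin m} {w x y z : Fin m → Fin N}
    (hxy : toLex x < toLex y) (hyz : toLex y < toLex z) (hx : LexLTAt l w x)
    (hz : LexLTAt l w z) : LexLTAt l w y := by
  have h := eq_of_toLex_between hxy hyz fun l' hl => (hx.1 l' hl).symm.trans (hz.1 l' hl)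
  exact ⟨fun l' hl => (hx.1 l' hl).trans (h l' hl),
    hx.2.trans_le (le_apply_of_toLex_lt hxy h)⟩

theorem LexLTAt.left_between {m N : ℕ} {l : Fin m} {w x y z : Fin m → Fin N}
    (hxy : toLex x < toLex y) (hyz : toLex y < toLex z) (hx : LexLTAt l x w)
    (hz : LexLTAt l z w) : LexLTAt l y w := by
  have h := eq_of_toLex_between hxy hyz fun l' hl => (hx.1 l' hl).trans (hz.1 l' hl).symm
  have h' : ∀ l' < l, y l' = z l' := fun l' hl =>
    (h l' hl).symm.trans ((hx.1 l' hl).trans (hz.1 l' hl).symm)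
  exact ⟨fun l' hl => (h l' hl).symm.trans (hx.1 l' hl),
    (le_apply_of_toLex_lt hyz h').trans_lt hz.2⟩

/-- The `k`-partite graph in which vertices `x` of part `i` and `y` of part `j`, with `i < j`, are
adjacent if `x` precedes `y` in the lexicographic order because of the coordinate `(i, j)`. -/
def layerGraph (k N : ℕ) : SimpleGraph (Fin k × (Fin (k * k) → Fin N)) where
  Adj u v := (u.1 < v.1 ∧ LexLTAt (finProdFinEquiv (u.1, v.1)) u.2 v.2) ∨
    (v.1 < u.1 ∧ LexLTAt (finProdFinEquiv (v.1, u.1)) v.2 u.2)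
  symm := ⟨fun _ _ h => h.symm⟩
  loopless := ⟨fun _ h => by simp at h⟩

theorem layerGraph_adj_of_lt {k N : ℕ} {u v : Fin k × (Fin (k * k) → Fin N)} (h : u.1 < v.1) :
    (layerGraph k N).Adj u v ↔ LexLTAt (finProdFinEquiv (u.1, v.1)) u.2 v.2 := by
  simp [layerGraph, h, h.not_gt]

theorem layerGraph_fst_ne {k N : ℕ} {u v : Fin k × (Fin (k * k) → Fin N)}
    (h : (layerGraph k N).Adj u v) : u.1 ≠ v.1 := by
  rcases h with h | h
  · exact h.1.ne
  · exact h.1.ne'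

theorem LexLTAt.not_triangle {m N : ℕ} {a b c : Fin m} {x y z : Fin m → Fin N}
    (hab : a ≠ b) (hac : a ≠ c) (hbc : b ≠ c) (hxy : LexLTAt a x y) (hxz : LexLTAt b x z)
    (hyz : LexLTAt c y z) : False := by
  rcases lt_or_gt_of_ne hab with h1 | h1 <;> rcases lt_or_gt_of_ne hac with h2 | h2 <;>
    rcases lt_or_gt_of_ne hbc with h3 | h3
  all_goals
    have := hxy.1; have := hxz.1; have := hyz.1
    have := hxy.2; have := hxz.2; have := hyz.2
    grind

theorem layerGraph_not_triangle {k N : ℕ} {u v w : Fin k × (Fin (k * k) → Fin N)}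
    (huv : (layerGraph k N).Adj u v) (huw : (layerGraph k N).Adj u w)
    (hvw : (layerGraph k N).Adj v w) : False := by
  wlog h1 : u.1 < v.1 generalizing u v
  · exact this huv.symm hvw huw ((layerGraph_fst_ne huv).symm.lt_of_le (not_lt.1 h1))
  wlog h2 : v.1 < w.1 generalizing u v w
  · have h2 := (layerGraph_fst_ne hvw).symm.lt_of_le (not_lt.1 h2)
    rcases lt_or_gt_of_ne (layerGraph_fst_ne huw) with h3 | h3
    · exact this huw huv hvw.symm h3 h2
    · exact this huw.symm hvw.symm huv h3 h1
  rw [layerGraph_adj_of_lt h1] at huv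
  rw [layerGraph_adj_of_lt h2] at hvw
  rw [layerGraph_adj_of_lt (h1.trans h2)] at huw
  refine LexLTAt.not_triangle ?_ ?_ ?_ huv huw hvw <;>
    simp [h1.ne, h2.ne]

theorem layerGraph_between {k N : ℕ} {v : Fin k × (Fin (k * k) → Fin N)} {i : Fin k}
    {x y z : Fin (k * k) → Fin N} (hxy : toLex x < toLex y) (hyz : toLex y < toLex z)
    (hx : (layerGraph k N).Adj v (i, x)) (hz : (layerGraph k N).Adj v (i, z)) :
    (layerGraph k N).Adj v (i, y) := by
  rcases hx with hx | hx <;> rcases hz with hz | hz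
  · exact Or.inl ⟨hx.1, hx.2.right_between hxy hyz hz.2⟩
  · exact absurd hx.1 hz.1.not_gt
  · exact absurd hx.1 hz.1.not_gt
  · exact Or.inr ⟨hx.1, hx.2.left_between hxy hyz hz.2⟩

/-- In every coloring of the layer graph by few colors, one can pick one color in each part
so that any two picked colors are joined by an edge. -/
theorem exists_colors_layerGraph {k N : ℕ} {W : Type*} [Finite W] (hN : Nat.card W ^ k < N)
    (col : Fin k × (Fin (k * k) → Fin N) → W) :
    ∃ c : Fin k → W, ∀ i j, i < j → ∃ x y, col (i, x) = c i ∧ col (j, y) = c j ∧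
      (layerGraph k N).Adj (i, x) (j, y) := by
  classical
  have := Fintype.ofFinite W
  suffices H : ∀ g h, h + g = k * k → ∀ z : Fin (k * k) → Fin N, ∃ c : Fin k → W,
      (∀ i, ∃ x, (∀ l : Fin (k * k), l < h → x l = z l) ∧ col (i, x) = c i) ∧
      ∀ i j, i < j → h ≤ finProdFinEquiv (i, j) → ∃ x y, col (i, x) = c i ∧ col (j, y) = c j ∧
        (layerGraph k N).Adj (i, x) (j, y) by
    obtain ⟨c, -, hc⟩ := H (k * k) 0 (by simp) fun _ => ⟨0, by omega⟩
    exact ⟨c, fun i j hij => hc i j hij (Nat.zero_le _)⟩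
  intro g
  induction g with
  | zero =>
    intro h hh z
    refine ⟨fun i => col (i, z), fun i => ⟨z, fun _ _ => rfl, rfl⟩, fun i j _ hl => ?_⟩
    have := (finProdFinEquiv (i, j)).2
    omega
  | succ g ih =>
    intro h hh z
    let l₀ : Fin (k * k) := ⟨h, by omega⟩
    choose c hc hadj using fun a : Fin N => ih (h + 1) (by omega) (Function.update z l₀ a)
    obtain ⟨a, b, hab, hcab⟩ : ∃ a b, a < b ∧ c a = c b := by
      obtain ⟨a, b, hne, heq⟩ := Fintype.exists_ne_map_eq_of_card_lt c (by
        simpa [Nat.card_eq_fintype_card] using hN)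
      rcases lt_or_gt_of_ne hne with hlt | hlt
      · exact ⟨a, b, hlt, heq⟩
      · exact ⟨b, a, hlt, heq.symm⟩
    refine ⟨c a, fun i => ?_, fun i j hij hl => ?_⟩
    · obtain ⟨x, hx, hcx⟩ := hc a i
      refine ⟨x, fun l hl => ?_, hcx⟩
      rw [hx l (by omega), Function.update_of_ne]
      rintro rfl
      exact lt_irrefl _ hl
    · rcases hl.lt_or_eq with hlt | heq
      · exact hadj a i j hij hlt
      · obtain ⟨x, hx, hcx⟩ := hc a i
        obtain ⟨y, hy, hcy⟩ := hc b j
        refine ⟨x, y, hcx, hcab ▸ hcy, (layerGraph_adj_of_lt hij).2 ?_⟩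
        have hl₀ : finProdFinEquiv (i, j) = l₀ := Fin.ext heq.symm
        change LexLTAt (finProdFinEquiv (i, j)) x y
        rw [hl₀]
        refine ⟨fun l hl => ?_, ?_⟩
        · have hl' : (l : ℕ) < h := hl
          rw [hx l (by omega), hy l (by omega), Function.update_of_ne hl.ne,
            Function.update_of_ne hl.ne]
        · rw [hx l₀ (Nat.lt_succ_self h), hy l₀ (Nat.lt_succ_self h)]
          simpa using hab

/-! ### The padded graph -/

/-- The vertices of `paddedGraph`: those of the layer graph, those attached to a part of the layer
graph (two classes for each part), and those of `u` further independent sets. -/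
abbrev PaddedVertex (k u N M : ℕ) : Type :=
  (Fin k × (Fin (k * k) → Fin N)) ⊕
    ((Fin k × Bool) × Fin M) ⊕ ((Fin u × Fin (2 * (k - 1))) × Fin M)

/-- The adjacency relation of `paddedGraph`. -/
def PaddedAdj {k u N M : ℕ} : PaddedVertex k u N M → PaddedVertex k u N M → Prop
  | .inl v, .inl w => (layerGraph k N).Adj v w
  | .inl v, .inr (.inl b) => v.1 = b.1.1
  | .inr (.inl b), .inl v => v.1 = b.1.1
  | .inr (.inl b), .inr (.inl b') => b.1.1 ≠ b'.1.1 ∧ b.1.2 ≠ b'.1.2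
  | .inr (.inr c), .inr (.inr c') => c.1.1 ≠ c'.1.1
  | .inl _, .inr (.inr _) => True
  | .inr (.inl _), .inr (.inr _) => True
  | .inr (.inr _), .inl _ => True
  | .inr (.inr _), .inr (.inl _) => True

/-- The layer graph enlarged by a bipartite graph that provides a large minimum degree, and joined
completely to a complete `u`-partite graph. -/
def paddedGraph (k u N M : ℕ) : SimpleGraph (PaddedVertex k u N M) where
  Adj := PaddedAdj
  symm := ⟨by
    rintro (v | b | c) (v' | b' | c') h
    · exact SimpleGraph.Adj.symm h
    all_goals simp_all [PaddedAdj, eq_comm]⟩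
  loopless := ⟨by rintro (v | b | c) h <;> simp [PaddedAdj] at h⟩

theorem paddedGraph_not_triangle {k u N M : ℕ}
    {x y z : (Fin k × (Fin (k * k) → Fin N)) ⊕ ((Fin k × Bool) × Fin M)}
    (hxy : (paddedGraph k u N M).Adj (x.map id Sum.inl) (y.map id Sum.inl))
    (hxz : (paddedGraph k u N M).Adj (x.map id Sum.inl) (z.map id Sum.inl))
    (hyz : (paddedGraph k u N M).Adj (y.map id Sum.inl) (z.map id Sum.inl)) : False := by
  rcases x with x | x <;> rcases y with y | y <;> rcases z with z | z <;>
    simp only [paddedGraph, PaddedAdj, Sum.map_inl, Sum.map_inr, id] at hxy hxz hyz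
  · exact layerGraph_not_triangle hxy hxz hyz
  · exact layerGraph_fst_ne hxy (hxz.trans hyz.symm)
  · exact layerGraph_fst_ne hxz (hxy.trans hyz.symm)
  · exact hyz.1 (hxy.symm.trans hxz)
  · exact layerGraph_fst_ne hyz (hxy.trans hxz.symm)
  · exact hxz.1 (hxy.symm.trans hyz)
  · exact hxy.1 (hxz.symm.trans hyz)
  · have hxy := hxy.2
    have hxz := hxz.2
    have hyz := hyz.2
    revert hxy hxz hyz
    cases x.1.2 <;> cases y.1.2 <;> cases z.1.2 <;> simp

theorem paddedGraph_cliqueFree (k u N M : ℕ) : (paddedGraph k u N M).CliqueFree (u + 3) := by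
  classical
  intro T hT
  let A := T.filter fun v => ∃ c, v = Sum.inr (Sum.inr c)
  let B := T.filter fun v => ¬ ∃ c, v = Sum.inr (Sum.inr c)
  have hcard : A.card + B.card = u + 3 :=
    (Finset.card_filter_add_card_filter_not _).trans hT.card_eq
  have hA : A.card ≤ u := by
    let g : PaddedVertex k u N M → Option (Fin u) :=
      Sum.elim (fun _ => none) (Sum.elim (fun _ => none) fun c => some c.1.1)
    have hmaps : ∀ v ∈ A, g v ∈ Finset.univ.map Function.Embedding.some := by
      intro v hv
      obtain ⟨c, rfl⟩ := (Finset.mem_filter.1 hv).2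
      simp [g]
    refine (Finset.card_le_card_of_injOn g hmaps ?_).trans (by simp)
    intro v hv w hw hvw
    obtain ⟨hvT, c, rfl⟩ := Finset.mem_filter.1 hv
    obtain ⟨hwT, c', rfl⟩ := Finset.mem_filter.1 hw
    by_contra hne
    exact hT.isClique hvT hwT hne (Option.some.inj hvw)
  have hB : 2 < B.card := by omega
  obtain ⟨x, y, z, hx, hy, hz, hxy, hxz, hyz⟩ := Finset.two_lt_card_iff.1 hB
  have hmem : ∀ v ∈ B, ∃ w, v = Sum.map id Sum.inl w := by
    rintro (v | v | v) hv
    · exact ⟨.inl v, rfl⟩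
    · exact ⟨.inr v, rfl⟩
    · exact absurd ⟨v, rfl⟩ (Finset.mem_filter.1 hv).2
  obtain ⟨x, rfl⟩ := hmem x hx
  obtain ⟨y, rfl⟩ := hmem y hy
  obtain ⟨z, rfl⟩ := hmem z hz
  have hT' := hT.isClique
  exact paddedGraph_not_triangle
    (hT' (Finset.mem_filter.1 hx).1 (Finset.mem_filter.1 hy).1 hxy)
    (hT' (Finset.mem_filter.1 hx).1 (Finset.mem_filter.1 hz).1 hxz)
    (hT' (Finset.mem_filter.1 hy).1 (Finset.mem_filter.1 hz).1 hyz)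

/-- The class of a vertex of `paddedGraph`. -/
def paddedClass {k u N M : ℕ} :
    PaddedVertex k u N M → Fin k ⊕ (Fin k × Bool) ⊕ (Fin u × Fin (2 * (k - 1))) :=
  Sum.map Prod.fst (Sum.map Prod.fst Prod.fst)

theorem paddedGraph_vcdimLE (k u N M : ℕ) :
    VCdimLE (paddedGraph k u N M)
      (2 * Fintype.card (Fin k ⊕ (Fin k × Bool) ⊕ (Fin u × Fin (2 * (k - 1))))) := by
  refine VCdimLE.of_classes _ paddedClass ?_
  rintro S hS (⟨i, x⟩ | ⟨b, a⟩ | ⟨b, a⟩) hx (⟨i', y⟩ | ⟨b', a'⟩ | ⟨b', a'⟩) hy z hz hxy hxz hyz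
    hp hp' <;>
    simp only [paddedClass, Sum.map_inl, Sum.map_inr, Sum.inl.injEq, Sum.inr.injEq,
      reduceCtorEq] at hp
  · rcases z with ⟨i'', z⟩ | z | z <;>
      simp only [paddedClass, Sum.map_inl, Sum.map_inr, Sum.inl.injEq, reduceCtorEq] at hp'
    subst hp hp'
    have key : ∀ {p q r : Fin (k * k) → Fin N}, Sum.inl (i, p) ∈ S → Sum.inl (i, q) ∈ S →
        Sum.inl (i, r) ∈ S → toLex p < toLex q → toLex q < toLex r → False := by
      intro p q r hp hq hr hpq hqr
      refine hS.not_between hp hq hr ?_ ?_ ?_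
      · rintro h
        simp only [Sum.inl.injEq, Prod.mk.injEq, true_and] at h
        exact hpq.ne (congrArg toLex h)
      · rintro h
        simp only [Sum.inl.injEq, Prod.mk.injEq, true_and] at h
        exact hqr.ne' (congrArg toLex h)
      · rintro (v | v | v) h1 h2
        · exact layerGraph_between hpq hqr h1 h2
        · exact h1
        · exact h1
    have hne : ∀ {p q : Fin (k * k) → Fin N},
        (Sum.inl (i, p) : PaddedVertex k u N M) ≠ Sum.inl (i, q) → toLex p ≠ toLex q := by
      rintro p q h h'
      exact h (by rw [toLex_inj.1 h'])
    rcases lt_or_gt_of_ne (hne hxy) with h1 | h1 <;> rcases lt_or_gt_of_ne (hne hxz) with h2 | h2 <;>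
      rcases lt_or_gt_of_ne (hne hyz) with h3 | h3
    · exact key hx hy hz h1 h3
    · exact key hx hz hy h2 h3
    · exact lt_asymm h1 (h3.trans h2)
    · exact key hz hx hy h2 h1
    · exact key hy hx hz h1 h2
    · exact lt_asymm h1 (h2.trans h3)
    · exact key hy hz hx h3 h2
    · exact key hz hy hx h3 h1
  · subst hp
    exact hS.not_between hx hy hx hxy hxy (by rintro (v | v | v) h _ <;> exact h)
  · subst hp
    exact hS.not_between hx hy hx hxy hxy (by rintro (v | v | v) h _ <;> exact h)

theorem card_le_ncard_of_injective {α V : Type*} [Finite V] {S : Set V} (g : α → V)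
    (hg : Function.Injective g) (hS : ∀ a, g a ∈ S) : Nat.card α ≤ S.ncard := by
  rw [← Nat.card_range_of_injective hg, Nat.card_coe_set_eq]
  exact Set.ncard_le_ncard (Set.range_subset_iff.2 hS)

theorem paddedGraph_degree {k u N M : ℕ} (hk : 3 ≤ k) (v : PaddedVertex k u N M) :
    2 * M + u * (2 * (k - 1)) * M ≤ ((paddedGraph k u N M).neighborSet v).ncard := by
  rcases v with v | b | c
  · refine le_trans (le_of_eq ?_) (card_le_ncard_of_injective
      (α := (Bool × Fin M) ⊕ ((Fin u × Fin (2 * (k - 1))) × Fin M))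
      (Sum.elim (fun a => .inr (.inl ((v.1, a.1), a.2))) fun c => .inr (.inr c)) ?_ ?_)
    · simp
    · rintro (⟨a, a'⟩ | a) (⟨b, b'⟩ | b) h <;> simp_all
    · rintro (a | a)
      · exact rfl
      · trivial
  · refine le_trans ?_ (card_le_ncard_of_injective
      (α := ({j : Fin k // j ≠ b.1.1} × Fin M) ⊕ ((Fin u × Fin (2 * (k - 1))) × Fin M))
      (Sum.elim (fun a => .inr (.inl ((a.1, !b.1.2), a.2))) fun c => .inr (.inr c)) ?_ ?_)
    · simp only [Nat.card_eq_fintype_card, Fintype.card_sum, Fintype.card_prod, Fintype.card_fin,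
        Fintype.card_subtype_compl, Fintype.card_subtype_eq]
      gcongr
      omega
    · rintro (⟨⟨a, ha⟩, a'⟩ | a) (⟨⟨b, hb⟩, b'⟩ | b) h <;> simp_all
    · rintro (a | a)
      · exact ⟨a.1.2.symm, by simp⟩
      · trivial
  · refine le_trans (le_of_eq ?_) (card_le_ncard_of_injective
      (α := ((Fin k × Bool) × Fin M) ⊕ (({j : Fin u // j ≠ c.1.1} × Fin (2 * (k - 1))) × Fin M))
      (Sum.elim (fun a => .inr (.inl a)) fun a => .inr (.inr ((a.1.1, a.1.2), a.2))) ?_ ?_)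
    · have hu : 0 < u := c.1.1.pos
      simp only [Nat.card_eq_fintype_card, Fintype.card_sum, Fintype.card_prod, Fintype.card_fin,
        Fintype.card_subtype_compl, Fintype.card_subtype_eq, Fintype.card_bool]
      obtain ⟨u, rfl⟩ := Nat.exists_eq_succ_of_ne_zero hu.ne'
      obtain ⟨k, rfl⟩ := Nat.exists_eq_add_of_le' (show 1 ≤ k by omega)
      simp only [Nat.succ_eq_add_one, Nat.add_sub_cancel]
      ring
    · rintro (a | ⟨⟨⟨a, ha⟩, a'⟩, a''⟩) (b | ⟨⟨⟨b, hb⟩, b'⟩, b''⟩) h <;> simp_all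
    · rintro (a | a)
      · trivial
      · exact a.1.1.2.symm

theorem paddedGraph_hom_not_cliqueFree {k u N M : ℕ} {W : Type*} [Finite W] (hk : 2 ≤ k)
    (hM : 0 < M) (hN : Nat.card W ^ k < N) {H : SimpleGraph W} (φ : paddedGraph k u N M →g H) :
    ¬ H.CliqueFree (k + u) := by
  obtain ⟨c, hc⟩ := exists_colors_layerGraph hN fun v => φ (Sum.inl v)
  have hc' : ∀ i, ∃ x, φ (Sum.inl (i, x)) = c i := by
    have : Nontrivial (Fin k) := Fin.nontrivial_iff_two_le.2 hk
    intro i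
    obtain ⟨j, hj⟩ := exists_ne i
    rcases lt_or_gt_of_ne hj with h | h
    · obtain ⟨x, y, -, hy, -⟩ := hc j i h
      exact ⟨y, hy⟩
    · obtain ⟨x, y, hx, -⟩ := hc i j h
      exact ⟨x, hx⟩
  have hcc : ∀ i j, i < j → H.Adj (c i) (c j) := by
    intro i j hij
    obtain ⟨x, y, hx, hy, hxy⟩ := hc i j hij
    rw [← hx, ← hy]
    exact φ.map_adj hxy
  let e : Fin u → PaddedVertex k u N M := fun j => .inr (.inr ((j, ⟨0, by omega⟩), ⟨0, hM⟩))
  have hce : ∀ i j, H.Adj (c i) (φ (e j)) := by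
    intro i j
    obtain ⟨x, hx⟩ := hc' i
    rw [← hx]
    exact φ.map_adj trivial
  let ψ : (⊤ : SimpleGraph (Fin k ⊕ Fin u)) →g H :=
    { toFun := Sum.elim c fun j => φ (e j)
      map_rel' := by
        rintro (i | i) (j | j) h
        · have hij : i ≠ j := by simpa using h
          rcases lt_or_gt_of_ne hij with h | h
          · exact hcc i j h
          · exact (hcc j i h).symm
        · exact hce i j
        · exact (hce j i).symm
        · have hij : i ≠ j := by simpa using h
          exact φ.map_adj hij }
  have h := (isNClique_map_copy_top ⟨ψ, Hom.injective_of_top_hom ψ⟩).not_cliqueFree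
  simpa using h

/-- Lower bound of Theorem 1.1: for `t ≥ s ≥ 3` and `ε > 0` there is `d` such that
for every `f ≥ 1` there is an `n`-vertex `Kₛ`-free graph `G` with VC-dimension at
most `d` and minimum degree at least `((s−3)(t−s+2)+1)/((s−2)(t−s+2)+1) − ε` times
`n`, such that every graph on at most `f` vertices admitting a homomorphism from
`G` contains a clique on `t` vertices. -/
theorem lower_bound_KsKt (s t : ℕ) (hs : 3 ≤ s) (hst : s ≤ t) (ε : ℝ) (hε : 0 < ε) :
    ∃ d : ℕ, ∀ f : ℕ, 1 ≤ f →
      ∃ (n : ℕ) (V : Type) (_ : Finite V) (G : SimpleGraph V),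
        Nat.card V = n ∧ G.CliqueFree s ∧ VCdimLE G d ∧
        (∀ v : V,
          ((((s : ℝ) - 3) * ((t : ℝ) - (s : ℝ) + 2) + 1) /
              (((s : ℝ) - 2) * ((t : ℝ) - (s : ℝ) + 2) + 1) - ε) * (n : ℝ) ≤
            (G.neighborSet v).ncard) ∧
        (∀ (W : Type) [Finite W], ∀ H : SimpleGraph W,
          Nat.card W ≤ f → Nonempty (G →g H) → ¬ H.CliqueFree t) := by
  obtain ⟨u, rfl⟩ := Nat.exists_eq_add_of_le' hs
  obtain ⟨r, rfl⟩ := Nat.exists_eq_add_of_le hst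
  set k := r + 3 with hk
  refine ⟨2 * Fintype.card (Fin k ⊕ (Fin k × Bool) ⊕ (Fin u × Fin (2 * (k - 1)))),
    fun f _ => ?_⟩
  set N := f ^ k + 1
  set q := k * N ^ (k * k)
  obtain ⟨M, hM⟩ := exists_nat_ge (q / (2 * ε))
  refine ⟨_, PaddedVertex k u N (M + 1), inferInstance, paddedGraph k u N (M + 1), rfl,
    paddedGraph_cliqueFree k u N _, paddedGraph_vcdimLE k u N _, fun v => ?_, ?_⟩
  · have hdeg := paddedGraph_degree (by omega) v
    refine le_trans ?_ (Nat.cast_le.2 hdeg)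
    have hcard : Nat.card (PaddedVertex k u N (M + 1)) =
        q + (k * 2 * (M + 1) + u * (2 * (k - 1)) * (M + 1)) := by
      simp [q]
    rw [hcard, show k - 1 = r + 2 by omega, hk]
    have hq : (q : ℝ) ≤ 2 * ε * (M + 1) := by
      rw [div_le_iff₀ (by positivity)] at hM
      linarith
    push_cast
    have hP : (u + 3 - 3 : ℝ) * (u + 3 + r - (u + 3) + 2) + 1 = u * (r + 2) + 1 := by ring
    have hQ : (u + 3 - 2 : ℝ) * (u + 3 + r - (u + 3) + 2) + 1 = (u + 1) * (r + 2) + 1 := by ring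
    rw [hP, hQ]
    set P : ℝ := u * (r + 2) + 1 with hPdef
    set Q : ℝ := (u + 1) * (r + 2) + 1 with hQdef
    have hr : (0 : ℝ) ≤ r := r.cast_nonneg
    have hu : (0 : ℝ) ≤ u := u.cast_nonneg
    have hPQ : P ≤ Q := by rw [hPdef, hQdef]; linarith
    have hQ1 : 1 ≤ Q := by
      rw [hQdef]
      have : (0 : ℝ) ≤ (u + 1) * (r + 2) := by positivity
      linarith
    have hdiv : P / Q ≤ 1 := (div_le_one (by linarith)).2 hPQ
    have hmul : P / Q * Q = P := div_mul_cancel₀ _ (by linarith)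
    have hn : (q : ℝ) + ((r + 3) * 2 * (M + 1) + u * (2 * (r + 2)) * (M + 1)) =
        q + Q * (2 * (M + 1)) := by rw [hQdef]; ring
    rw [hn]
    have hq0 : (0 : ℝ) ≤ q := q.cast_nonneg
    have hM0 : (0 : ℝ) ≤ M := M.cast_nonneg
    calc (P / Q - ε) * (q + Q * (2 * (M + 1)))
        = P / Q * Q * (2 * (M + 1)) + P / Q * q - ε * q - Q * (2 * ε * (M + 1)) := by ring
      _ ≤ P * (2 * (M + 1)) + 1 * q - 0 - 1 * (2 * ε * (M + 1)) := by
        rw [hmul]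
        gcongr
        positivity
      _ ≤ P * (2 * (M + 1)) := by linarith
      _ = 2 * (M + 1) + u * (2 * (r + 2)) * (M + 1) := by rw [hPdef]; ring
  · rintro W _ H hW ⟨φ⟩
    have h := paddedGraph_hom_not_cliqueFree (by omega) M.succ_pos
      (Nat.lt_succ_of_le (Nat.pow_le_pow_left hW k)) φ
    rwa [show u + 3 + r = k + u by omega]
end

section
/- Lemma 2.1: For every integer t ≥ 3 and every ε > 0, there exists an integer d = d(t,ε) such that for every integer f ≥ 1 there exist an integer n and an n-vertex triangle-free (K_3-free) graph G with VC-dimension at most d and minimum degree δ(G) ≥ (1/t − ε)·n, such that every graph H with at most f vertices admitting a graph homomorphism from G to H contains a clique on t vertices. -/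
open SimpleGraph

/-- Vertices of the construction: `t` copies of the pairs from `Fin N`, which form the core, and
`2 * t` classes of `m` vertices each, which provide the degrees. -/
abbrev ShiftVertex (t N m : ℕ) : Type :=
  (Fin t × Fin N × Fin N) ⊕ (Fin t × Bool × Fin m)

/-- The edges of the core form a `t`-partite shift graph. The other vertices form a blow-up of
`K_{t,t}` minus a perfect matching, and the `i`-th part of the core is joined to the two classes
of index `i`. -/
def ShiftAdj {t N m : ℕ} : ShiftVertex t N m → ShiftVertex t N m → Prop
  | .inl (i, a, b), .inl (j, c, e) =>
      (i < j ∧ a < b ∧ b = c ∧ c < e) ∨ (j < i ∧ c < e ∧ e = a ∧ a < b)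
  | .inl (i, _), .inr (j, _) => i = j
  | .inr (i, _), .inl (j, _) => i = j
  | .inr (i, s, _), .inr (j, s', _) => i ≠ j ∧ s ≠ s'

/-- The multipartite shift graph with a degree-boosting bipartite part attached. -/
def shiftGraph (t N m : ℕ) : SimpleGraph (ShiftVertex t N m) where
  Adj := ShiftAdj
  symm := ⟨by
    rintro (⟨i, a, b⟩ | ⟨i, s, k⟩) (⟨j, c, e⟩ | ⟨j, s', k'⟩) h <;>
      simp only [ShiftAdj] at h ⊢ <;> grind⟩
  loopless := ⟨by rintro (⟨i, a, b⟩ | ⟨i, s, k⟩) h <;> simp [ShiftAdj] at h⟩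

theorem shiftGraph_cliqueFree (t N m : ℕ) : (shiftGraph t N m).CliqueFree 3 := by
  intro T hT
  obtain ⟨x, y, z, hxy, hxz, hyz, -⟩ := is3Clique_iff.mp hT
  change ShiftAdj x y at hxy
  change ShiftAdj x z at hxz
  change ShiftAdj y z at hyz
  rcases x with ⟨i, a, b⟩ | ⟨i, s, k⟩ <;> rcases y with ⟨j, c, e⟩ | ⟨j, s', k'⟩ <;>
    rcases z with ⟨l, g, h⟩ | ⟨l, s'', k''⟩ <;> simp only [ShiftAdj] at hxy hxz hyz <;> try grind
  obtain ⟨-, h₁⟩ := hxy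
  obtain ⟨-, h₂⟩ := hxz
  obtain ⟨-, h₃⟩ := hyz
  cases s <;> cases s' <;> cases s'' <;> contradiction

theorem Shattered.exists_adj_not_adj {V : Type*} {G : SimpleGraph V} {S T : Set V}
    (hS : Shattered G S) (hT : T ⊆ S) :
    ∃ v, (∀ x ∈ T, G.Adj v x) ∧ ∀ x ∈ S, x ∉ T → ¬ G.Adj v x := by
  obtain ⟨v, hv⟩ := hS T hT
  refine ⟨v, fun x hx => ?_, fun x hx hxT hadj => hxT ?_⟩
  · rw [← hv] at hx
    exact hx.1
  · rw [← hv]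
    exact ⟨hadj, hx⟩

/-- The class of a vertex: its part in the core, or its twin class outside the core. -/
def shiftClass {t N m : ℕ} : ShiftVertex t N m → Fin t × Option Bool
  | .inl (i, _) => (i, none)
  | .inr (i, s, _) => (i, some s)

/-- A vertex that separates two vertices of one part of the core selects from this part the
pairs with a prescribed first entry, or those with a prescribed second entry. -/
theorem shiftGraph_separating_trace {t N m : ℕ} {j : Fin t} {p q : Fin N × Fin N}
    {v : ShiftVertex t N m} (hp : (shiftGraph t N m).Adj v (.inl (j, p)))
    (hq : ¬ (shiftGraph t N m).Adj v (.inl (j, q))) :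
    (∃ b, ∀ r, (shiftGraph t N m).Adj v (.inl (j, r)) ↔ r.1 = b ∧ r.1 < r.2) ∨
      ∃ a, ∀ r, (shiftGraph t N m).Adj v (.inl (j, r)) ↔ r.2 = a ∧ r.1 < r.2 := by
  obtain ⟨p₁, p₂⟩ := p
  obtain ⟨q₁, q₂⟩ := q
  rcases v with ⟨i, a, b⟩ | ⟨i, s, k⟩
  · simp only [shiftGraph, ShiftAdj] at hp ⊢
    rcases lt_trichotomy i j with h | h | h
    · exact Or.inl ⟨b, by grind⟩
    · grind
    · exact Or.inr ⟨a, by grind⟩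
  · exact absurd hp hq

theorem shiftGraph_vcdimLE (t N m : ℕ) : VCdimLE (shiftGraph t N m) (6 * t) := by
  classical
  intro S hS
  by_contra! hcard
  rw [Set.ncard_eq_toFinset_card'] at hcard
  obtain ⟨⟨j, o⟩, -, hfib⟩ := Finset.exists_lt_card_fiber_of_mul_lt_card_of_maps_to
    (s := S.toFinset) (t := Finset.univ) (f := shiftClass) (n := 2)
    (fun _ _ => Finset.mem_univ _) (by
      rw [Finset.card_univ, Fintype.card_prod, Fintype.card_option, Fintype.card_bool,
        Fintype.card_fin]
      omega)
  obtain ⟨x, hx, y, hy, z, hz, hxy, hxz, hyz⟩ := Finset.two_lt_card.mp hfib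
  simp only [Finset.mem_filter, Set.mem_toFinset] at hx hy hz
  obtain ⟨hxS, hxc⟩ := hx
  obtain ⟨hyS, hyc⟩ := hy
  obtain ⟨hzS, hzc⟩ := hz
  have key : ∀ x ∈ S, ∀ y ∈ S, ∀ z ∈ S, x ≠ z → y ≠ z →
      ∃ v, (shiftGraph t N m).Adj v x ∧ (shiftGraph t N m).Adj v y ∧
        ¬ (shiftGraph t N m).Adj v z := by
    intro x hx y hy z hz hxz hyz
    obtain ⟨v, h₁, h₂⟩ := hS.exists_adj_not_adj (T := {x, y}) (by grind)
    exact ⟨v, h₁ x (by simp), h₁ y (by simp), h₂ z hz (by grind)⟩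
  obtain ⟨u, hux, huy, huz⟩ := key x hxS y hyS z hzS hxz hyz
  obtain ⟨v, hvx, hvz, hvy⟩ := key x hxS z hzS y hyS hxy hyz.symm
  obtain ⟨w, hwy, hwz, hwx⟩ := key y hyS z hzS x hxS hxy.symm hxz.symm
  rcases x with ⟨j₁, p⟩ | ⟨j₁, s, k⟩ <;> rcases y with ⟨j₂, q⟩ | ⟨j₂, s', k'⟩ <;>
    rcases z with ⟨j₃, r⟩ | ⟨j₃, s'', k''⟩ <;>
    simp only [shiftClass, Prod.mk.injEq] at hxc hyc hzc <;> try grind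
  · obtain ⟨rfl, -⟩ := hxc
    obtain ⟨rfl, -⟩ := hyc
    obtain ⟨rfl, -⟩ := hzc
    rcases shiftGraph_separating_trace hux huz with ⟨b₁, h₁⟩ | ⟨b₁, h₁⟩ <;>
      rcases shiftGraph_separating_trace hvx hvy with ⟨b₂, h₂⟩ | ⟨b₂, h₂⟩ <;>
      rcases shiftGraph_separating_trace hwy hwx with ⟨b₃, h₃⟩ | ⟨b₃, h₃⟩ <;>
      rw [h₁] at hux huy huz <;> rw [h₂] at hvx hvy hvz <;> rw [h₃] at hwx hwy hwz <;> grind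
  · obtain ⟨rfl, rfl⟩ := hxc
    obtain ⟨rfl, hs⟩ := hyc
    obtain rfl := Option.some_injective _ hs
    apply hwx
    rcases w with ⟨i, a, b⟩ | ⟨i, s₁, k₁⟩ <;> exact hwy

theorem shiftGraph_le_ncard_neighborSet {t N m : ℕ} (ht : 3 ≤ t) (v : ShiftVertex t N m) :
    2 * m ≤ ((shiftGraph t N m).neighborSet v).ncard := by
  suffices h : ∃ g : Bool × Fin m → ShiftVertex t N m, Function.Injective g ∧
      ∀ x, (shiftGraph t N m).Adj v (g x) by
    obtain ⟨g, hg, hadj⟩ := h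
    calc 2 * m = (Set.range g).ncard := by
          rw [← Set.image_univ, Set.ncard_image_of_injective _ hg, Set.ncard_univ]
          simp
      _ ≤ _ := Set.ncard_le_ncard (by rintro _ ⟨x, rfl⟩; exact hadj x) (Set.toFinite _)
  rcases v with ⟨i, p⟩ | ⟨i, s, k⟩
  · exact ⟨fun x => .inr (i, x), fun x y h => by simpa using h, fun x => rfl⟩
  · have hcard : 1 < (Finset.univ.erase i).card := by
      rw [Finset.card_erase_of_mem (Finset.mem_univ _), Finset.card_fin]
      omega
    obtain ⟨j₁, h₁, j₂, h₂, hne⟩ := Finset.one_lt_card.mp hcard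
    refine ⟨fun x => .inr (if x.1 then j₁ else j₂, !s, x.2), ?_, ?_⟩
    · rintro ⟨β, k₁⟩ ⟨β', k₂⟩ h
      cases β <;> cases β' <;> simp_all
    · rintro ⟨β, k₁⟩
      change i ≠ _ ∧ s ≠ !s
      cases β <;> simp_all [eq_comm]

/-- Every colouring of the pairs `a < b` with few colours has a monochromatic edge of the
shift graph. -/
theorem exists_monochromatic_shift {N : ℕ} {C : Type*} [Finite C] (hN : 2 ^ Nat.card C < N)
    (col : Fin N → Fin N → C) : ∃ a b c, a < b ∧ b < c ∧ col a b = col b c := by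
  have := Fintype.ofFinite C
  have hcard : Fintype.card (Set C) < Fintype.card (Fin N) := by
    simpa [Nat.card_eq_fintype_card] using hN
  obtain ⟨a, b, hab, h⟩ := Fintype.exists_ne_map_eq_of_card_lt
    (fun a => {x | ∃ b, a < b ∧ col a b = x}) hcard
  wlog hlt : a < b generalizing a b
  · exact this b a hab.symm h.symm (lt_of_le_of_ne (not_lt.mp hlt) hab.symm)
  obtain ⟨c, hbc, hc⟩ := h.le ⟨b, hlt, rfl⟩
  exact ⟨a, b, c, hlt, hbc, hc.symm⟩

theorem shiftGraph_hom_not_cliqueFree {t N m : ℕ} {W : Type*} [Finite W] {H : SimpleGraph W}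
    (hN : 2 ^ Nat.card W ^ t < N) (φ : shiftGraph t N m →g H) : ¬ H.CliqueFree t := by
  obtain ⟨a, b, c, hab, hbc, hcol⟩ := exists_monochromatic_shift (C := Fin t → W)
    (by simpa [Nat.card_fun] using hN) (fun a b i => φ (.inl (i, a, b)))
  have hlt : ∀ i j, i < j → H.Adj (φ (.inl (i, a, b))) (φ (.inl (j, a, b))) := by
    intro i j hij
    rw [congrFun hcol j]
    exact φ.map_rel (Or.inl ⟨hij, hab, rfl, hbc⟩)
  have hadj : ∀ i j, i ≠ j → H.Adj (φ (.inl (i, a, b))) (φ (.inl (j, a, b))) := fun i j hij =>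
    hij.lt_or_gt.elim (hlt i j) fun h => (hlt j i h).symm
  rw [not_cliqueFree_iff_top_isContained]
  refine ⟨⟨⟨fun i => φ (.inl (i, a, b)), fun {i j} => hadj i j⟩, fun i j h => ?_⟩⟩
  by_contra hij
  exact (hadj i j hij).ne h

/-- Lemma 2.1: for `t ≥ 3` and `ε > 0` there is `d` such that for every `f ≥ 1`
there is an `n`-vertex triangle-free graph `G` with VC-dimension at most `d` and
minimum degree at least `(1/t − ε)·n`, such that every graph on at most `f`
vertices admitting a homomorphism from `G` contains a clique on `t` vertices. -/
theorem lower_bound_triangle (t : ℕ) (ht : 3 ≤ t) (ε : ℝ) (hε : 0 < ε) :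
    ∃ d : ℕ, ∀ f : ℕ, 1 ≤ f →
      ∃ (n : ℕ) (V : Type) (_ : Finite V) (G : SimpleGraph V),
        Nat.card V = n ∧ G.CliqueFree 3 ∧ VCdimLE G d ∧
        (∀ v : V, ((1 : ℝ) / (t : ℝ) - ε) * (n : ℝ) ≤ (G.neighborSet v).ncard) ∧
        (∀ (W : Type) [Finite W], ∀ H : SimpleGraph W,
          Nat.card W ≤ f → Nonempty (G →g H) → ¬ H.CliqueFree t) := by
  refine ⟨6 * t, fun f _ => ?_⟩
  set N := 2 ^ f ^ t + 1 with hN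
  obtain ⟨m, hm⟩ := exists_nat_gt ((N : ℝ) ^ 2 / ε)
  refine ⟨_, ShiftVertex t N m, inferInstance, shiftGraph t N m, rfl, shiftGraph_cliqueFree t N m,
    shiftGraph_vcdimLE t N m, fun v => ?_, fun W _ H hW ⟨φ⟩ => ?_⟩
  · have hdeg : (2 * m : ℝ) ≤ ((shiftGraph t N m).neighborSet v).ncard := by
      exact_mod_cast shiftGraph_le_ncard_neighborSet ht v
    refine le_trans ?_ hdeg
    have hn : (Nat.card (ShiftVertex t N m) : ℝ) = t * (N ^ 2 + 2 * m) := by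
      simp [Nat.card_eq_fintype_card]
      ring
    rw [hn]
    rw [div_lt_iff₀ hε] at hm
    have ht' : (3 : ℝ) ≤ t := by exact_mod_cast ht
    have hmain : (N : ℝ) ^ 2 ≤ ε * (t * (N ^ 2 + 2 * m)) := by
      have h₁ : (m : ℝ) ≤ t * (N ^ 2 + 2 * m) := by
        nlinarith [sq_nonneg (N : ℝ), (Nat.cast_nonneg m : (0 : ℝ) ≤ m)]
      nlinarith
    have hcancel : (1 : ℝ) / t * (t * (N ^ 2 + 2 * m)) = N ^ 2 + 2 * m := by
      field_simp
    rw [sub_mul, hcancel]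
    linarith
  · refine shiftGraph_hom_not_cliqueFree (Nat.lt_succ_of_le ?_) φ
    gcongr
    norm_num
end

section
/- First part of Theorem 1.2: For every integer k ≥ 2, every ε > 0 and every integer d ≥ 1, there exists a constant C = C(k,ε,d) such that the following holds. If G is a finite simple graph on n vertices containing no cycle of any odd length ℓ with 3 ≤ ℓ ≤ 2k+1, with VC-dimension at most d and minimum degree δ(G) ≥ ε·n, then there exists a graph H with at most C vertices containing no cycle of any odd length ℓ with 3 ≤ ℓ ≤ 2k−1, together with a graph homomorphism from G to H. -/
open SimpleGraph

/-- `G` contains a cycle of length `ℓ`. -/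
def HasCycleOfLength {V : Type*} (G : SimpleGraph V) (ℓ : ℕ) : Prop :=
  ∃ (v : V) (w : G.Walk v v), w.IsCycle ∧ w.length = ℓ

namespace SimpleGraph

variable {V : Type*} {G : SimpleGraph V}

/-- An even path does not contain the edge joining its endpoints. -/
lemma Walk.IsPath.notMem_edges_of_even_length {u w : V} {q : G.Walk w u} (hq : q.IsPath)
    (he : Even q.length) : s(u, w) ∉ q.edges := by
  intro hmem
  cases q with
  | nil => simp at hmem
  | cons h r =>
    rw [Walk.cons_isPath_iff] at hq
    rw [Walk.edges_cons, List.mem_cons] at hmem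
    rcases hmem with hmem | hmem
    · rw [Sym2.eq_swap] at hmem
      obtain rfl := Sym2.congr_right.mp hmem
      rw [Walk.length_cons, Walk.length_eq_zero_iff.mpr (Walk.isPath_iff_nil.mp hq.1)] at he
      simp at he
    · exact hq.2 (r.snd_mem_support_of_mem_edges hmem)

/-- A walk can be shortened to a path of the same parity unless there is a short odd cycle. -/
lemma Walk.exists_isPath_or_odd_isCycle {u v : V} (p : G.Walk u v) :
    (∃ q : G.Walk u v, q.IsPath ∧ q.length ≤ p.length ∧ (Even q.length ↔ Even p.length)) ∨
      ∃ (x : V) (c : G.Walk x x), c.IsCycle ∧ Odd c.length ∧ c.length ≤ p.length := by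
  classical
  induction p with
  | nil => exact Or.inl ⟨.nil, by simp⟩
  | @cons u w v h p ih =>
    rcases ih with ⟨q, hq, hle, hpar⟩ | ⟨x, c, hc, ho, hle⟩
    · by_cases hu : u ∈ q.support
      · have hlen : (q.takeUntil u hu).length + (q.dropUntil u hu).length = q.length := by
          rw [← Walk.length_append, Walk.take_spec]
        have htake := hq.takeUntil hu
        by_cases he : Even (q.takeUntil u hu).length
        · refine Or.inr ⟨u, .cons h (q.takeUntil u hu), ?_, ?_, ?_⟩
          · exact (Walk.cons_isCycle_iff _ _).mpr ⟨htake, htake.notMem_edges_of_even_length he⟩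
          · simpa using he.add_one
          · simp only [Walk.length_cons]
            omega
        · refine Or.inl ⟨q.dropUntil u hu, hq.dropUntil hu, ?_, ?_⟩
          · simp only [Walk.length_cons]
            omega
          · rw [← hlen] at hpar
            simp only [Walk.length_cons]
            grind
      · refine Or.inl ⟨.cons h q, (Walk.cons_isPath_iff _ _).mpr ⟨hq, hu⟩, ?_, ?_⟩
        · simpa using hle
        · simp only [Walk.length_cons, Nat.even_add_one, hpar]
    · exact Or.inr ⟨x, c, hc, ho, hle.trans (by simp)⟩

/-- An odd closed walk yields an odd cycle that is no longer. -/
lemma Walk.exists_odd_isCycle {u : V} (p : G.Walk u u) (hp : Odd p.length) :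
    ∃ (x : V) (c : G.Walk x x), c.IsCycle ∧ Odd c.length ∧ c.length ≤ p.length := by
  rcases p.exists_isPath_or_odd_isCycle with ⟨q, hq, -, hpar⟩ | h
  · have hnil := Walk.length_eq_zero_iff.mpr (Walk.isPath_iff_nil.mp hq)
    exact absurd (hpar.mp (by simp [hnil])) (Nat.not_even_iff_odd.mpr hp)
  · exact h

/-- Colours for the depth-`r` refinement of a colouring with `M` colours. -/
def RefinedColor (M : ℕ) : ℕ → Type
  | 0 => Fin M
  | r + 1 => RefinedColor M r × Set (RefinedColor M r)

instance RefinedColor.finite (M : ℕ) : ∀ r, Finite (RefinedColor M r)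
  | 0 => inferInstanceAs (Finite (Fin M))
  | r + 1 =>
    have := RefinedColor.finite M r
    inferInstanceAs (Finite (RefinedColor M r × Set (RefinedColor M r)))

/-- Iterated colour refinement: each step also records the colours occurring in the
neighbourhood. -/
def refinedColor (G : SimpleGraph V) {M : ℕ} (f : V → Fin M) : (r : ℕ) → V → RefinedColor M r
  | 0 => f
  | r + 1 => fun v => (refinedColor G f r v, refinedColor G f r '' G.neighborSet v)

variable {M : ℕ} {f : V → Fin M}

lemma refinedColor_eq_of_le {r s : ℕ} (hrs : r ≤ s) {u v : V}
    (h : refinedColor G f s u = refinedColor G f s v) :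
    refinedColor G f r u = refinedColor G f r v := by
  induction s, hrs using Nat.le_induction with
  | base => exact h
  | succ s _ ih => exact ih (congrArg Prod.fst h)

lemma exists_adj_refinedColor_eq {r : ℕ} {u v w : V}
    (h : refinedColor G f (r + 1) u = refinedColor G f (r + 1) v) (hw : G.Adj v w) :
    ∃ x, G.Adj u x ∧ refinedColor G f r x = refinedColor G f r w := by
  have hs : refinedColor G f r '' G.neighborSet u = refinedColor G f r '' G.neighborSet v :=
    congrArg Prod.snd h
  have hmem : refinedColor G f r w ∈ refinedColor G f r '' G.neighborSet v := ⟨w, hw, rfl⟩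
  rwa [← hs] at hmem

/-- The quotient of `G` by the colour classes of the depth-`r` refinement. -/
def refinedQuotient (G : SimpleGraph V) (f : V → Fin M) (r : ℕ) :
    SimpleGraph (RefinedColor M r) where
  Adj x y := x ≠ y ∧ ∃ a b, G.Adj a b ∧ refinedColor G f r a = x ∧ refinedColor G f r b = y
  symm := ⟨fun _ _ ⟨hne, a, b, hab, ha, hb⟩ => ⟨hne.symm, b, a, hab.symm, hb, ha⟩⟩
  loopless := ⟨fun _ h => h.1 rfl⟩

/-- A walk in the depth-`r` quotient lifts to a walk in `G`, losing one level of refinement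
per step. -/
lemma exists_walk_of_refinedQuotient_walk {r : ℕ} {x y : RefinedColor M r}
    (p : (refinedQuotient G f r).Walk x y) {j : ℕ} (hj : j + p.length ≤ r) {a v : V}
    (ha : refinedColor G f r a = x)
    (hv : refinedColor G f (j + p.length) v = refinedColor G f (j + p.length) a) :
    ∃ (u b : V) (q : G.Walk v u), q.length = p.length ∧ refinedColor G f r b = y ∧
      refinedColor G f j u = refinedColor G f j b := by
  induction p generalizing a v with
  | nil => exact ⟨v, a, .nil, rfl, ha, hv⟩
  | cons h p ih =>
    rw [Walk.length_cons] at hj hv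
    obtain ⟨-, a', b', hab, ha', hb'⟩ := h
    have hva : refinedColor G f (j + p.length + 1) v = refinedColor G f (j + p.length + 1) a' :=
      hv.trans (refinedColor_eq_of_le hj (ha.trans ha'.symm))
    obtain ⟨w, hvw, hw⟩ := exists_adj_refinedColor_eq hva hab
    obtain ⟨u, b, q, hq, hb, hu⟩ := ih (by omega) hb' hw
    exact ⟨u, b, .cons hvw q, congrArg (· + 1) hq, hb, hu⟩

open Finset in
/-- If a bounded number of neighbourhoods is pairwise separated by a sample, the
Sauer–Shelah lemma bounds their number. -/
lemma card_le_of_injOn_neighborSet_inter [DecidableEq V] [G.LocallyFinite] {d m : ℕ}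
    (hd : VCdimLE G d) {S X : Finset V} (hX : #X ≤ m)
    (hinj : Set.InjOn (fun v => G.neighborFinset v ∩ X) S) :
    #S ≤ ∑ i ∈ range (d + 1), m ^ i := by
  set A := S.image (fun v => G.neighborFinset v ∩ X)
  have hsub : A.shatterer ⊆ (range (d + 1)).biUnion (fun i => X.powersetCard i) := by
    intro s hs
    rw [mem_shatterer] at hs
    have hsX : s ⊆ X := by
      obtain ⟨t, ht, hst⟩ := hs.exists_superset
      obtain ⟨v, -, rfl⟩ := mem_image.mp ht
      exact hst.trans inter_subset_right
    have hcard : #s ≤ d := by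
      rw [← Set.ncard_coe_finset]
      refine hd s fun t ht => ?_
      lift t to Finset V using s.finite_toSet.subset ht
      obtain ⟨u, hu, hut⟩ := hs (coe_subset.mp ht)
      obtain ⟨v, -, rfl⟩ := mem_image.mp hu
      refine ⟨v, ?_⟩
      rw [← hut]
      ext z
      have : z ∈ s → z ∈ X := fun h => hsX h
      simp
      tauto
    simp only [mem_biUnion, mem_range, mem_powersetCard]
    exact ⟨#s, by omega, hsX, rfl⟩
  calc #S = #A := (card_image_of_injOn hinj).symm
    _ ≤ #A.shatterer := card_le_card_shatterer A
    _ ≤ ∑ i ∈ range (d + 1), #(X.powersetCard i) := (card_le_card hsub).trans card_biUnion_le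
    _ ≤ ∑ i ∈ range (d + 1), m ^ i := by
      refine sum_le_sum fun i _ => ?_
      rw [card_powersetCard]
      exact (Nat.choose_le_pow _ _).trans (Nat.pow_le_pow_left hX i)

open Finset in
/-- A small random sample meets every member of a small family of dense sets. -/
lemma exists_sample_meeting [Fintype V] [Nonempty V] [DecidableEq V] {ι : Type*} (I : Finset ι)
    (D : ι → Finset V) {r : ℝ} {m : ℕ} (hD : ∀ i ∈ I, (#(D i)ᶜ : ℝ) ≤ r * Fintype.card V)
    (hm : #I * r ^ m < 1) : ∃ X : Finset V, #X ≤ m ∧ ∀ i ∈ I, (D i ∩ X).Nonempty := by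
  set bad := I.biUnion (fun i => Fintype.piFinset fun _ : Fin m => (D i)ᶜ)
  have hn : (0 : ℝ) < Fintype.card V := by exact_mod_cast Fintype.card_pos
  have hbad : (#bad : ℝ) < Fintype.card (Fin m → V) := by
    calc (#bad : ℝ) ≤ ∑ i ∈ I, (#(D i)ᶜ : ℝ) ^ m := by
          have := card_biUnion_le (s := I)
            (t := fun i => Fintype.piFinset fun _ : Fin m => (D i)ᶜ)
          simp only [Fintype.card_piFinset_const] at this
          exact_mod_cast this
      _ ≤ ∑ i ∈ I, (r * Fintype.card V) ^ m := by
          gcongr with i hi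
          exact hD i hi
      _ = (#I * r ^ m) * (Fintype.card V : ℝ) ^ m := by
          rw [sum_const, nsmul_eq_mul, mul_pow, mul_assoc]
      _ < 1 * (Fintype.card V : ℝ) ^ m := by gcongr
      _ = Fintype.card (Fin m → V) := by simp
  obtain ⟨g, hg⟩ : ∃ g, g ∉ bad := by
    by_contra! h
    rw [eq_univ_of_forall h, card_univ] at hbad
    exact lt_irrefl _ hbad
  refine ⟨univ.image g, card_image_le.trans (by simp), fun i hi => ?_⟩
  have hgi : ¬ ∀ t, g t ∈ (D i)ᶜ := fun h =>
    hg (mem_biUnion.mpr ⟨i, hi, Fintype.mem_piFinset.mpr h⟩)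
  push Not at hgi
  obtain ⟨t, ht⟩ := hgi
  exact ⟨g t, by simpa using ht⟩

open Finset in
/-- Packing lemma: for bounded VC-dimension, only boundedly many neighbourhoods can be
pairwise far apart. -/
lemma exists_card_lt_of_separated (d : ℕ) {ε : ℝ} (hε : 0 < ε) :
    ∃ M : ℕ, ∀ (V : Type) [Fintype V] [DecidableEq V] [Nonempty V] (G : SimpleGraph V)
      [DecidableRel G.Adj], VCdimLE G d → ∀ S : Finset V,
      (∀ s ∈ S, ∀ t ∈ S, s ≠ t →
        ε * Fintype.card V ≤ #(symmDiff (G.neighborFinset s) (G.neighborFinset t))) →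
      #S < M := by
  set r : ℝ := 1 - min ε (1 / 2) with hr
  have hr0 : 0 ≤ r := by linarith [min_le_right ε (1 / 2)]
  have hr1 : r < 1 := by
    have : 0 < min ε (1 / 2) := lt_min hε (by norm_num)
    linarith
  obtain ⟨m, hm1, hm⟩ : ∃ m : ℕ, 1 ≤ m ∧
      (((∑ i ∈ range (d + 1), m ^ i) + 1 : ℕ) : ℝ) ^ 2 * r ^ m < 1 := by
    have hlim := (tendsto_pow_const_mul_const_pow_of_abs_lt_one (2 * d)
      (abs_lt.mpr ⟨by linarith, hr1⟩)).const_mul (((d : ℝ) + 2) ^ 2)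
    rw [mul_zero] at hlim
    obtain ⟨m, hlt, hm1⟩ :=
      ((hlim.eventually_lt_const one_pos).and (Filter.eventually_ge_atTop 1)).exists
    refine ⟨m, hm1, lt_of_le_of_lt ?_ hlt⟩
    have hsum : (∑ i ∈ range (d + 1), m ^ i) + 1 ≤ (d + 2) * m ^ d := by
      have h1 : ∑ i ∈ range (d + 1), m ^ i ≤ ∑ _i ∈ range (d + 1), m ^ d :=
        sum_le_sum fun i hi => Nat.pow_le_pow_right hm1 (by simp at hi; omega)
      have h2 : 1 ≤ m ^ d := Nat.one_le_pow _ _ hm1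
      rw [sum_const, card_range, smul_eq_mul] at h1
      linarith
    calc _ ≤ (((d + 2) * m ^ d : ℕ) : ℝ) ^ 2 * r ^ m := by gcongr
      _ = _ := by push_cast; ring
  refine ⟨(∑ i ∈ range (d + 1), m ^ i) + 1, fun V _ _ _ G _ hd S hS => ?_⟩
  by_contra! hcard
  obtain ⟨T, hTS, hT⟩ := exists_subset_card_eq hcard
  obtain ⟨X, hX, hmeet⟩ := exists_sample_meeting T.offDiag
    (fun p => symmDiff (G.neighborFinset p.1) (G.neighborFinset p.2)) (r := r) (m := m)
    (fun p hp => by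
      rw [mem_offDiag] at hp
      have h := hS _ (hTS hp.1) _ (hTS hp.2.1) hp.2.2
      rw [card_compl, Nat.cast_sub (card_le_univ _)]
      have : min ε (1 / 2) * (Fintype.card V : ℝ) ≤ ε * Fintype.card V := by
        gcongr
        exact min_le_left _ _
      rw [hr, sub_mul]
      linarith)
    (lt_of_le_of_lt (by
      rw [← hT]
      gcongr
      rw [offDiag_card, sq]
      exact_mod_cast Nat.sub_le _ _) hm)
  have hinj : Set.InjOn (fun v => G.neighborFinset v ∩ X) T := by
    intro s hs t ht hst
    by_contra hne
    obtain ⟨z, hz⟩ := hmeet (s, t) (mem_offDiag.mpr ⟨hs, ht, hne⟩)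
    have hz' := Finset.ext_iff.mp hst z
    simp only [mem_inter, mem_symmDiff] at hz hz'
    tauto
  have := card_le_of_injOn_neighborSet_inter hd hX hinj
  omega

open Finset in
/-- For bounded VC-dimension and linear minimum degree, boundedly many colours suffice to
make any two vertices of the same colour have a common neighbour. -/
lemma exists_coloring_common_neighbor (d : ℕ) {ε : ℝ} (hε : 0 < ε) :
    ∃ M : ℕ, ∀ (V : Type) [Fintype V] (G : SimpleGraph V), VCdimLE G d →
      (∀ v : V, ε * (Nat.card V) ≤ (G.neighborSet v).ncard) →
      ∃ f : V → Fin M, ∀ u v, f u = f v → ∃ w, G.Adj u w ∧ G.Adj v w := by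
  classical
  obtain ⟨M, hM⟩ := exists_card_lt_of_separated d hε
  refine ⟨M, fun V _ G hd hdeg => ?_⟩
  cases isEmpty_or_nonempty V
  · exact ⟨isEmptyElim, fun u => isEmptyElim u⟩
  replace hdeg (v : V) : ε * Fintype.card V ≤ #(G.neighborFinset v) := by
    have := hdeg v
    rwa [← coe_neighborFinset, Set.ncard_coe_finset, Nat.card_eq_fintype_card] at this
  let sep (S : Finset V) : Prop := ∀ s ∈ S, ∀ t ∈ S, s ≠ t →
    ε * Fintype.card V ≤ #(symmDiff (G.neighborFinset s) (G.neighborFinset t))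
  obtain ⟨S, hS⟩ := (Set.toFinite {S : Finset V | sep S}).exists_maximal ⟨∅, by simp [sep]⟩
  have hnear (v : V) : ∃ s : S,
      (#(symmDiff (G.neighborFinset v) (G.neighborFinset s)) : ℝ) < ε * Fintype.card V := by
    by_contra! hfar
    have hins : sep (insert v S) := by
      intro s hs t ht hst
      rw [mem_insert] at hs ht
      rcases hs with rfl | hs <;> rcases ht with rfl | ht
      · exact absurd rfl hst
      · exact hfar ⟨t, ht⟩
      · rw [symmDiff_comm]
        exact hfar ⟨s, hs⟩
      · exact hS.prop s hs t ht hst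
    have hv : v ∈ S := hS.le_of_ge hins (subset_insert v S) (mem_insert_self v S)
    have h := hfar ⟨v, hv⟩
    have hpos : 0 < ε * (Fintype.card V : ℝ) := mul_pos hε (by exact_mod_cast Fintype.card_pos)
    simp only [symmDiff_self, bot_eq_empty, card_empty, Nat.cast_zero] at h
    linarith
  choose g hg using hnear
  refine ⟨fun v => Fin.castLE (hM V G hd S hS.prop).le (S.equivFin (g v)), fun u v huv => ?_⟩
  have hguv : g u = g v := S.equivFin.injective (Fin.castLE_injective _ huv)
  by_contra! hno
  have hdisj : Disjoint (G.neighborFinset u) (G.neighborFinset v) := by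
    rw [Finset.disjoint_left]
    intro w hu hv
    exact hno w (by simpa using hu) (by simpa using hv)
  have hle : #(G.neighborFinset u) + #(G.neighborFinset v) ≤
      #(symmDiff (G.neighborFinset u) (G.neighborFinset (g u))) +
        #(symmDiff (G.neighborFinset v) (G.neighborFinset (g v))) := by
    rw [← card_union_of_disjoint hdisj, hguv]
    refine (card_le_card ?_).trans (card_union_le _ _)
    intro w hw
    have : w ∈ G.neighborFinset u → w ∉ G.neighborFinset v :=
      fun h => Finset.disjoint_left.mp hdisj h
    simp only [mem_union, mem_symmDiff] at hw ⊢
    tauto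
  have hle' : (#(G.neighborFinset u) : ℝ) + #(G.neighborFinset v) ≤
      #(symmDiff (G.neighborFinset u) (G.neighborFinset (g u))) +
        #(symmDiff (G.neighborFinset v) (G.neighborFinset (g v))) := by exact_mod_cast hle
  linarith [hdeg u, hdeg v, hg u, hg v]

end SimpleGraph

/-- First part of Theorem 1.2: for `k ≥ 2`, `ε > 0` and `d ≥ 1` there is a constant
`C` such that every graph `G` with no odd cycle of length between `3` and `2k+1`,
VC-dimension at most `d` and minimum degree at least `ε·n` admits a homomorphism
to a graph on at most `C` vertices with no odd cycle of length between `3` and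
`2k−1`. -/
theorem odd_cycles_hom_shrink (k : ℕ) (hk : 2 ≤ k) (ε : ℝ) (hε : 0 < ε)
    (d : ℕ) (hd : 1 ≤ d) :
    ∃ C : ℕ, ∀ (V : Type) [Fintype V] (G : SimpleGraph V),
      (∀ ℓ : ℕ, 3 ≤ ℓ → ℓ ≤ 2 * k + 1 → Odd ℓ → ¬ HasCycleOfLength G ℓ) →
      VCdimLE G d →
      (∀ v : V, ε * (Nat.card V) ≤ (G.neighborSet v).ncard) →
      ∃ (W : Type) (_ : Finite W) (H : SimpleGraph W),
        Nat.card W ≤ C ∧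
        (∀ ℓ : ℕ, 3 ≤ ℓ → ℓ ≤ 2 * k - 1 → Odd ℓ → ¬ HasCycleOfLength H ℓ) ∧
        Nonempty (G →g H) := by
  obtain ⟨M, hM⟩ := exists_coloring_common_neighbor d hε
  refine ⟨Nat.card (RefinedColor M (2 * k - 1)), fun V _ G hcyc hvc hdeg => ?_⟩
  obtain ⟨f, hf⟩ := hM V G hvc hdeg
  have hclosed {v : V} (p : G.Walk v v) (hp : Odd p.length) : 2 * k + 1 < p.length := by
    by_contra! hle
    obtain ⟨x, c, hc, ho, hcp⟩ := p.exists_odd_isCycle hp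
    exact hcyc c.length hc.three_le_length (hcp.trans hle) ho ⟨x, c, hc, rfl⟩
  refine ⟨RefinedColor M (2 * k - 1), inferInstance, refinedQuotient G f (2 * k - 1), le_rfl,
    ?_, ⟨⟨refinedColor G f (2 * k - 1), fun {a b} hab => ⟨fun heq => ?_, a, b, hab, rfl, rfl⟩⟩⟩⟩
  · rintro ℓ h3 hℓ hodd ⟨x, p, -, rfl⟩
    obtain ⟨a, ha⟩ : ∃ a, refinedColor G f (2 * k - 1) a = x := by
      cases p with
      | nil => simp at h3
      | cons h _ =>
        obtain ⟨-, a, -, -, ha, -⟩ := h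
        exact ⟨a, ha⟩
    obtain ⟨u, b, q, hq, hb, hu⟩ :=
      exists_walk_of_refinedQuotient_walk p (j := 0) (v := a) (by omega) ha rfl
    obtain ⟨w, huw, haw⟩ := hf u a
      (hu.trans (refinedColor_eq_of_le (Nat.zero_le _) (hb.trans ha.symm)))
    have hlen : (q.append (.cons huw (.cons haw.symm .nil))).length = p.length + 2 := by
      simp [hq]
    have := hclosed (q.append (.cons huw (.cons haw.symm .nil)))
      (hlen ▸ hodd.add_even even_two)
    omega
  · obtain ⟨w, haw, hbw⟩ := hf a b (refinedColor_eq_of_le (Nat.zero_le _) heq)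
    have := hclosed (.cons hab (.cons hbw (.cons haw.symm .nil))) (by simp; decide)
    simp only [Walk.length_cons, Walk.length_nil] at this
    omega
end
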